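/- Let p be an odd prime, K a finite field extension of ℚ_p, Q a nondegenerate quadratic form on an n-dimensional K-vector space, and Q₀ an anisotropic quadratic form of degree d over K Witt equivalent to Q. Let λ ∈ Λ(n), let a (respectively b) be the number of distinct odd values occurring in λ with multiplicity exactly 1 (respectively exactly 2), and let c be the number of distinct odd values occurring in λ with multiplicity at least 3. Let N be the number of orbits of the conjugation action of O(Q) on the set of nilpotent elements of so(Q) of Jordan type λ. Then, as integers: if c ≥ 1, 8N = 4^a·7^b·8^c; if c = 0 and a > 0, 8N = 4^a·7^b + (2−d)·2^{a+1}; and if a = c = 0, then N = (7^b − (−1)^b)/8 + ε, where ε = 1 if d = 0 and b is even, ε = −1 if d = 4 and b is odd, and ε = 0 otherwise. -/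

import Mathlib

/-- A quadratic form of degree `m` over `K`: a quadratic form on `Fin m → K`. -/
abbrev QF (K : Type) [Field K] (m : ℕ) : Type := QuadraticForm K (Fin m → K)

/-- Two quadratic forms are isometric if there is a linear equivalence of the underlying
spaces carrying one to the other. -/
def QIsom {K : Type} [Field K] {M M' : Type} [AddCommGroup M] [Module K M]
    [AddCommGroup M'] [Module K M'] (Q : QuadraticForm K M) (Q' : QuadraticForm K M') : Prop :=
  ∃ φ : M ≃ₗ[K] M', ∀ x, Q' (φ x) = Q x

/-- The hyperbolic plane `(x, y) ↦ x * y` on `K²`. -/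
noncomputable def HypForm (K : Type) [Field K] : QuadraticForm K (K × K) :=
  QuadraticMap.linMulLin (LinearMap.fst K K K) (LinearMap.snd K K K)

/-- Orthogonal sum of `m` copies of the hyperbolic plane. -/
noncomputable def HypSum (K : Type) [Field K] (m : ℕ) : QuadraticForm K (Fin m → K × K) :=
  QuadraticMap.pi (fun _ : Fin m => HypForm K)

/-- Witt equivalence of quadratic forms. -/
def WittEquiv {K : Type} [Field K] {M M' : Type} [AddCommGroup M] [Module K M]
    [AddCommGroup M'] [Module K M'] (Q : QuadraticForm K M) (Q' : QuadraticForm K M') : Prop :=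
  ∃ a b : ℕ, QIsom (Q.prod (HypSum K a)) (Q'.prod (HypSum K b))

/-- A quadratic form is nondegenerate if its polar bilinear form is nondegenerate. -/
def QNondeg {K : Type} [Field K] {M : Type} [AddCommGroup M] [Module K M]
    (Q : QuadraticForm K M) : Prop :=
  ∀ v, (∀ w, QuadraticMap.polar (⇑Q) v w = 0) → v = 0

/-- The diagonal quadratic form `⟨a₁, …, a_m⟩`. -/
noncomputable def diagQF {K : Type} [Field K] {m : ℕ} (r : Fin m → Kˣ) : QF K m :=
  QuadraticMap.weightedSumSquares K (fun i => (r i : K))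

/-- The Lie algebra `so(Q)`. -/
def soSet {K : Type} [Field K] {M : Type} [AddCommGroup M] [Module K M]
    (Q : QuadraticForm K M) : Set (Module.End K M) :=
  {X | ∀ v w, QuadraticMap.polar (⇑Q) (X v) w + QuadraticMap.polar (⇑Q) v (X w) = 0}

/-- Membership in the orthogonal group `O(Q)` (as invertible linear maps preserving `Q`). -/
def InO {K : Type} [Field K] {M : Type} [AddCommGroup M] [Module K M]
    (Q : QuadraticForm K M) (g : M ≃ₗ[K] M) : Prop :=
  ∀ v, Q (g v) = Q v

/-- Membership in the special orthogonal group `SO(Q)`. -/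
def InSO {K : Type} [Field K] {M : Type} [AddCommGroup M] [Module K M]
    (Q : QuadraticForm K M) (g : M ≃ₗ[K] M) : Prop :=
  InO Q g ∧ LinearMap.det (g : M →ₗ[K] M) = 1

/-- A nilpotent endomorphism has Jordan type `λ` when `dim ker (X^i) = Σ_j min(i, λ_j)`. -/
def HasJordanType {K : Type} [Field K] {M : Type} [AddCommGroup M] [Module K M]
    {n : ℕ} (X : Module.End K M) (lam : Nat.Partition n) : Prop :=
  ∀ i : ℕ, Module.finrank K (LinearMap.ker (X ^ i)) = (lam.parts.map (fun part => min i part)).sum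

/-- `Λ(n)`: partitions of `n` in which every even part has even multiplicity. -/
def LambdaSet (n : ℕ) : Set (Nat.Partition n) :=
  {lam | ∀ j : ℕ, Even j → Even (lam.parts.count j)}



set_option linter.all false

section PieceOne
open scoped NormedField Valued NNReal

section LocalField
variable {K : Type} [NontriviallyNormedField K] [IsUltrametricDist K] [ProperSpace K]

theorem lf_sq_of_near_one (h2 : ‖(2:K)‖ = 1) (x : K) (hx : ‖x - 1‖ < 1) : ∃ y, y^2 = x := by
  obtain ⟨y, hy, hmin⟩ := (isCompact_closedBall (0:K) 1).exists_isMinOn (f := fun y => ‖y^2 - x‖)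
    ⟨1, by simp⟩ (by fun_prop)
  have hy1 : ‖y‖ ≤ 1 := by simpa using hy
  have hr : ‖y^2 - x‖ < 1 := by
    have := hmin (show (1:K) ∈ Metric.closedBall (0:K) 1 by simp)
    change ‖y^2 - x‖ ≤ ‖(1:K)^2 - x‖ at this
    refine lt_of_le_of_lt this ?_
    rwa [norm_sub_rev, one_pow]
  by_cases h0 : y^2 - x = 0
  · exact ⟨y, sub_eq_zero.mp h0⟩
  exfalso
  have hxn : ‖x‖ = 1 := by
    have : ‖(x - 1) + 1‖ = max ‖x-1‖ ‖(1:K)‖ := IsUltrametricDist.norm_add_eq_max_of_norm_ne_norm (by simp; exact hx.ne)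
    simp at this; rw [this]; exact max_eq_right hx.le
  have hyn : ‖y‖ = 1 := by
    have : ‖(y^2 - x) + x‖ = max ‖y^2 - x‖ ‖x‖ := IsUltrametricDist.norm_add_eq_max_of_norm_ne_norm (by rw [hxn]; exact hr.ne)
    rw [hxn, max_eq_right hr.le, sub_add_cancel, norm_pow] at this
    exact (pow_eq_one_iff_of_nonneg (norm_nonneg _) two_ne_zero).1 this
  have hy0 : y ≠ 0 := by intro h; simp [h] at hyn
  have h20 : (2:K) ≠ 0 := by intro h; simp [h] at h2
  set e := (y^2 - x)/(2*y) with he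
  have hen : ‖e‖ = ‖y^2 - x‖ := by simp [he, h2, hyn]
  have hsub : ‖y - e‖ ≤ 1 := by
    have := IsUltrametricDist.norm_add_le_max y (-e)
    rw [norm_neg, ← sub_eq_add_neg] at this
    refine this.trans (max_le hy1 (by rw [hen]; exact hr.le))
  have h3 := hmin (show y - e ∈ Metric.closedBall (0:K) 1 by simpa using hsub)
  have h4 : (y-e)^2 - x = e^2 := by
    have : 2*y*e = y^2 - x := by rw [he]; field_simp
    linear_combination -this
  change ‖y^2 - x‖ ≤ ‖(y-e)^2 - x‖ at h3
  rw [h4, norm_pow, hen] at h3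
  have hpos : 0 < ‖y^2 - x‖ := norm_pos_iff.2 h0
  nlinarith

theorem lf_residue_eq_zero_iff (x : 𝒪[K]) : IsLocalRing.residue 𝒪[K] x = 0 ↔ ‖(x:K)‖ < 1 := by
  rw [IsLocalRing.residue_eq_zero_iff, IsLocalRing.mem_maximalIdeal, mem_nonunits_iff,
    Valued.integer.isUnit_iff_norm_eq_one]
  have := Valued.integer.norm_le_one x
  exact ⟨fun h => lt_of_le_of_ne this h, fun h => h.ne⟩

theorem lf_residue_finite : Finite (IsLocalRing.ResidueField 𝒪[K]) := by
  obtain ⟨t, -, ht, hcov⟩ := (isCompact_closedBall (0:K) 1).finite_cover_balls (e := 1) one_pos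
  let f : t → IsLocalRing.ResidueField 𝒪[K] := fun y =>
    if h : ‖(y:K)‖ ≤ 1 then IsLocalRing.residue 𝒪[K] ⟨y, Valued.integer.mem_iff.2 h⟩ else 0
  have := ht.to_subtype
  refine Finite.of_surjective f ?_
  intro r
  obtain ⟨x, rfl⟩ := IsLocalRing.residue_surjective r
  have hx : (x:K) ∈ Metric.closedBall (0:K) 1 := by simpa using Valued.integer.norm_le_one x
  have := hcov hx
  simp only [Set.mem_iUnion, Metric.mem_ball, exists_prop] at this
  obtain ⟨y, hy, hxy⟩ := this
  rw [dist_eq_norm] at hxy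
  have hyn : ‖y‖ ≤ 1 := by
    have := IsUltrametricDist.norm_add_le_max (x:K) (-((x:K)-y))
    rw [norm_neg] at this
    have h2 : (x:K) + -((x:K)-y) = y := by ring
    rw [h2] at this
    exact this.trans (max_le (Valued.integer.norm_le_one x) hxy.le)
  refine ⟨⟨y, hy⟩, ?_⟩
  simp only [f, hyn, dite_true]
  rw [eq_comm, ← sub_eq_zero, ← map_sub, lf_residue_eq_zero_iff]
  simpa using hxy

theorem lf_unif : ∃ π : K, 0 < ‖π‖ ∧ ‖π‖ < 1 ∧ ∀ x : K, x ≠ 0 → ∃ n : ℤ, ‖x‖ = ‖π‖ ^ n := by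
  have hcl : IsClosed {x : K | ‖x‖ < 1} := by
    have := IsUltrametricDist.isClosed_ball (0:K) 1
    simpa [Metric.ball, dist_eq_norm] using this
  have hcomp : IsCompact {x : K | ‖x‖ < 1} :=
    (isCompact_closedBall (0:K) 1).of_isClosed_subset hcl (fun x hx => by
      simpa using le_of_lt hx)
  obtain ⟨π, hπ, hmax⟩ := hcomp.exists_isMaxOn (f := fun y => ‖y‖) ⟨0, by simp⟩ (by fun_prop)
  obtain ⟨z, hz, hz'⟩ := NormedField.exists_norm_lt_one K
  have hπ0 : 0 < ‖π‖ := lt_of_lt_of_le hz (hmax hz')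
  refine ⟨π, hπ0, hπ, fun x hx => ?_⟩
  obtain ⟨n, hn1, hn2⟩ := exists_mem_Ioc_zpow (x := ‖x‖) (y := ‖π‖⁻¹) (norm_pos_iff.2 hx)
    (by exact (one_lt_inv₀ hπ0).2 hπ)
  refine ⟨-(n+1), ?_⟩
  by_contra hne
  rw [← inv_zpow'] at hne
  have hlt : ‖x‖ < ‖π‖⁻¹ ^ (n+1) := lt_of_le_of_ne hn2 hne
  have h1 : ‖x * π ^ (n+1)‖ < 1 := by
    rw [norm_mul, norm_zpow]
    rw [inv_zpow] at hlt
    calc _ < (‖π‖ ^ (n+1))⁻¹ * ‖π‖ ^ (n+1) := by gcongr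
      _ = 1 := inv_mul_cancel₀ (by positivity)
  have h2 : ‖x * π ^ (n+1)‖ ≤ ‖π‖ := hmax h1
  rw [norm_mul, norm_zpow, zpow_add_one₀ hπ0.ne', ← mul_assoc] at h2
  have h3 : ‖x‖ * ‖π‖ ^ n ≤ 1 := by
    by_contra h; push Not at h; nlinarith
  rw [inv_zpow] at hn1
  have : 1 < ‖x‖ * ‖π‖ ^ n := by
    calc (1:ℝ) = (‖π‖ ^ n)⁻¹ * ‖π‖ ^ n := (inv_mul_cancel₀ (by positivity)).symm
      _ < _ := by gcongr
  linarith

theorem lf_facts (h2 : ‖(2:K)‖ = 1) : ∃ u π : Kˣ,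
    (∀ x : Kˣ, ∃ y : Kˣ, x = y^2 ∨ x = u*y^2 ∨ x = π*y^2 ∨ x = u*π*y^2) ∧
    (∀ x y z w : K, x^2 - u*y^2 + π*(z^2 - u*w^2) = 0 → x = 0 ∧ y = 0 ∧ z = 0 ∧ w = 0) ∧
    ((∃ y : Kˣ, -1 = y^2) ∨ ((∃ y : Kˣ, -1 = u*y^2) ∧ ∃ r s : K, r^2+s^2 = -1)) := by
  obtain ⟨π, hπ0, hπ1, hπ⟩ := lf_unif (K := K)
  have hfin := lf_residue_finite (K := K)
  let := Fintype.ofFinite (IsLocalRing.ResidueField 𝒪[K])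
  set k := IsLocalRing.ResidueField 𝒪[K] with hk
  let res := IsLocalRing.residue 𝒪[K]
  classical
  have hchar : ringChar k ≠ 2 := by
    intro h
    have h20 : ((2:ℕ):k) = 0 := by rw [← h]; exact ringChar.Nat.cast_ringChar
    have : res 2 = 0 := by
      have e : res 2 = ((2:ℕ):k) := by rw [map_ofNat]; rfl
      rw [e, h20]
    rw [lf_residue_eq_zero_iff] at this
    exact absurd h2 this.ne
  obtain ⟨ub, hub⟩ := FiniteField.exists_nonsquare hchar
  obtain ⟨u, rfl⟩ := IsLocalRing.residue_surjective ub
  have hu0 : res u ≠ 0 := by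
    intro h; apply hub; change IsSquare (res u); rw [h]; exact IsSquare.zero
  have hnu : ∀ x : 𝒪[K], res x ≠ 0 ↔ ‖(x:K)‖ = 1 := fun x => by
    rw [Ne, lf_residue_eq_zero_iff, not_lt]
    exact ⟨fun h => le_antisymm (Valued.integer.norm_le_one x) h, fun h => h.ge⟩
  have hun := (hnu u).1 hu0
  have huK : (u:K) ≠ 0 := by intro h; simp [h] at hun
  -- unit with residue a square is a square
  have hsq : ∀ x : K, ∀ hx : ‖x‖ = 1, IsSquare (res ⟨x, Valued.integer.mem_iff.2 hx.le⟩) →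
      ∃ y : K, x = y^2 := by
    intro x hx ⟨c, hc⟩
    obtain ⟨y, rfl⟩ := IsLocalRing.residue_surjective c
    change res _ = res _ * res _ at hc
    have hy : res y ≠ 0 := by
      intro h; rw [h, mul_zero] at hc; exact ((hnu _).2 hx) hc
    have hyn := (hnu y).1 hy
    have hy0 : (y:K) ≠ 0 := by intro h; simp [h] at hyn
    rw [← sub_eq_zero, ← map_mul, ← map_sub, lf_residue_eq_zero_iff] at hc
    obtain ⟨z, hz⟩ := lf_sq_of_near_one h2 (x / (y:K)^2) (by
      have : x / (y:K)^2 - 1 = (x - y*y)/(y:K)^2 := by field_simp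
      rw [this, norm_div, norm_pow, hyn]; simpa using hc)
    exact ⟨z * y, by rw [mul_pow, hz]; field_simp⟩
  have hunit : ∀ x : K, ‖x‖ = 1 → ∃ y : K, x = y^2 ∨ x = u * y^2 := by
    intro x hx
    by_cases hs : IsSquare (res ⟨x, Valued.integer.mem_iff.2 hx.le⟩)
    · obtain ⟨y, hy⟩ := hsq x hx hs; exact ⟨y, Or.inl hy⟩
    · have hxu : ‖x * u‖ = 1 := by rw [norm_mul, hx, hun, one_mul]
      have : IsSquare (res ⟨x*u, Valued.integer.mem_iff.2 hxu.le⟩) := by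
        have e : res ⟨x*u, Valued.integer.mem_iff.2 hxu.le⟩ =
          res ⟨x, Valued.integer.mem_iff.2 hx.le⟩ * res u := by rw [← map_mul]; rfl
        have hne := (hnu ⟨x*u, Valued.integer.mem_iff.2 hxu.le⟩).2 hxu
        rw [← quadraticChar_one_iff_isSquare hne, e, map_mul,
          quadraticChar_neg_one_iff_not_isSquare.2 hs, quadraticChar_neg_one_iff_not_isSquare.2 hub]
        norm_num
      obtain ⟨y, hy⟩ := hsq _ hxu this
      exact ⟨y / u, Or.inr (by rw [div_pow, ← hy]; field_simp)⟩
  have hπK : π ≠ 0 := norm_pos_iff.1 hπ0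
  have hnorm : ∀ x y : K, x^2 - u*y^2 = 0 ∧ x = 0 ∧ y = 0 ∨ ∃ n : ℤ, ‖x^2 - u*y^2‖ = ‖π‖^(2*n) := by
    have key : ∀ z : K, ‖z‖ ≤ 1 → ‖z^2 - u‖ = 1 := by
      intro z hz
      by_contra hne
      apply hub
      let z' : 𝒪[K] := ⟨z, Valued.integer.mem_iff.2 hz⟩
      have h0 : res (z'^2 - u) = 0 := by
        by_contra h; exact hne (by simpa using (hnu _).1 h)
      refine ⟨res z', ?_⟩
      rw [map_sub, sub_eq_zero, map_pow, sq] at h0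
      exact h0.symm
    have key2 : ∀ z : K, ‖z‖ < 1 → ‖1 - u*z^2‖ = 1 := by
      intro z hz
      have h3 : ‖-(u*z^2)‖ < 1 := by
        rw [norm_neg, norm_mul, hun, one_mul, norm_pow]
        exact pow_lt_one₀ (norm_nonneg _) hz two_ne_zero
      have : ‖(1:K) + -(u*z^2)‖ = max ‖(1:K)‖ ‖-(u*z^2)‖ :=
        IsUltrametricDist.norm_add_eq_max_of_norm_ne_norm (by rw [norm_one]; exact h3.ne')
      rw [norm_one, max_eq_left h3.le] at this
      rwa [sub_eq_add_neg]
    intro x y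
    by_cases hxy : ‖x‖ ≤ ‖y‖
    · by_cases hy : y = 0
      · subst hy; simp at hxy; subst hxy; left; simp
      · right
        obtain ⟨n, hn⟩ := hπ y hy
        refine ⟨n, ?_⟩
        have h := key (x/y) (by rw [norm_div]; exact div_le_one_of_le₀ hxy (norm_nonneg _))
        have e : x^2 - u*y^2 = ((x/y)^2 - u) * y^2 := by field_simp
        rw [e, norm_mul, h, one_mul, norm_pow, hn, mul_comm, zpow_mul]; rfl
    · push Not at hxy
      have hx : x ≠ 0 := by intro h; subst h; simp at hxy; exact absurd hxy (not_lt.2 (norm_nonneg _))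
      right
      obtain ⟨n, hn⟩ := hπ x hx
      refine ⟨n, ?_⟩
      have h := key2 (y/x) (by rw [norm_div]; exact (div_lt_one (norm_pos_iff.2 hx)).2 hxy)
      have e : x^2 - u*y^2 = (1 - u*(y/x)^2) * x^2 := by field_simp
      rw [e, norm_mul, h, one_mul, norm_pow, hn, mul_comm, zpow_mul]; rfl
  refine ⟨Units.mk0 u huK, Units.mk0 π hπK, ?_, ?_, ?_⟩
  · intro x
    obtain ⟨n, hn⟩ := hπ x x.ne_zero
    have hv : ‖(x:K) / π^n‖ = 1 := by
      rw [norm_div, norm_zpow, hn]; exact div_self (zpow_pos hπ0 n).ne'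
    have hπn : π^n ≠ 0 := zpow_ne_zero n hπK
    obtain ⟨y, hy⟩ := hunit _ hv
    have hy0 : y ≠ 0 := by
      rintro rfl
      rcases hy with hy | hy <;> (rw [hy] at hv; simp at hv)
    rcases Int.even_or_odd' n with ⟨m, hm | hm⟩
    · have hpm : π^n = (π^m)^2 := by rw [hm, mul_comm, zpow_mul]; exact zpow_ofNat _ 2
      have hm0 : π^m ≠ 0 := zpow_ne_zero m hπK
      refine ⟨Units.mk0 (y * π^m) (mul_ne_zero hy0 hm0), ?_⟩
      rcases hy with hy | hy
      · left; ext; simp; rw [mul_pow, ← hpm, ← hy]; field_simp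
      · right; left; ext; simp; rw [mul_pow, ← hpm, ← mul_assoc, ← hy]; field_simp
    · have hpm : π^n = π * (π^m)^2 := by rw [hm, zpow_add_one₀ hπK, mul_comm, mul_comm 2 m, zpow_mul, zpow_ofNat]
      have hm0 : π^m ≠ 0 := zpow_ne_zero m hπK
      refine ⟨Units.mk0 (y * π^m) (mul_ne_zero hy0 hm0), ?_⟩
      rcases hy with hy | hy
      · right; right; left; ext; simp; rw [mul_pow, mul_left_comm, ← hpm, ← hy]; field_simp
      · right; right; right; ext; simp
        have : (u:K) * π * (y*π^m)^2 = (u * y^2) * (π * (π^m)^2) := by ring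
        rw [this, ← hpm, ← hy]; field_simp
  · intro x y z w h
    simp only [Units.val_mk0] at h
    have hlt : ∀ a b : ℤ, ‖π‖^a = ‖π‖^b → a = b := fun a b hab =>
      zpow_right_injective₀ hπ0 hπ1.ne hab
    rcases hnorm x y with ⟨h1, hx, hy⟩ | ⟨n, hn⟩
    · rcases hnorm z w with ⟨h3, hz, hw⟩ | ⟨m, hm⟩
      · exact ⟨hx, hy, hz, hw⟩
      · rw [h1, zero_add] at h
        rcases mul_eq_zero.1 h with h | h
        · exact absurd h hπK
        · rw [h, norm_zero] at hm; exact absurd hm (zpow_pos hπ0 _).ne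
    · rcases hnorm z w with ⟨h3, hz, hw⟩ | ⟨m, hm⟩
      · rw [h3, mul_zero, add_zero] at h
        rw [h, norm_zero] at hn; exact absurd hn (zpow_pos hπ0 _).ne
      · have e : x^2 - u*y^2 = -(π * (z^2 - u*w^2)) := by linear_combination h
        rw [e, norm_neg, norm_mul, hm, ← zpow_one_add₀ hπ0.ne'] at hn
        have := hlt _ _ hn
        omega
  · obtain ⟨y, hy⟩ := hunit (-1) (by simp)
    have hy0 : y ≠ 0 := by
      rintro rfl; simp at hy
    rcases hy with hy | hy
    · left; exact ⟨Units.mk0 y hy0, by ext; simpa using hy⟩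
    · right; refine ⟨⟨Units.mk0 y hy0, by ext; simpa using hy⟩, ?_⟩
      obtain ⟨a, b, hab⟩ := FiniteField.exists_root_sum_quadratic (R := k)
        (f := Polynomial.X^2) (g := Polynomial.X^2 - Polynomial.C (-1))
        (Polynomial.degree_X_pow 2) (Polynomial.degree_X_pow_sub_C (by decide) _)
        (FiniteField.odd_card_of_char_ne_two hchar)
      simp at hab
      have hsq' : ∀ a b : k, b ≠ 0 → a^2 + (b^2 + 1) = 0 → ∃ r s : K, r^2+s^2 = -1 := by
        intro a b hb hab
        obtain ⟨a, rfl⟩ := IsLocalRing.residue_surjective a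
        have hx : ‖-1 - (a:K)^2‖ = 1 := by
          have h1 : res (-1 - a^2) ≠ 0 := by
            intro h
            rw [map_sub, map_neg, map_one, map_pow] at h
            apply hb
            have : b^2 = 0 := by
              have h' : -1 - (IsLocalRing.residue 𝒪[K] a)^2 = 0 := h
              linear_combination hab + h'
            exact pow_eq_zero_iff two_ne_zero |>.1 this
          simpa using (hnu _).1 h1
        obtain ⟨s, hs⟩ := hsq _ hx ⟨b, by
          have e : res ⟨-1 - (a:K)^2, Valued.integer.mem_iff.2 hx.le⟩ = res (-1 - a^2) := rfl
          rw [e, map_sub, map_neg, map_one, map_pow]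
          change -1 - (IsLocalRing.residue 𝒪[K] a)^2 = _
          linear_combination -hab⟩
        exact ⟨a, s, by rw [← hs]; ring⟩
      by_cases hb : b = 0
      · refine hsq' b a ?_ (by linear_combination hab)
        rintro rfl; subst hb; simp at hab
      · exact hsq' a b hb hab
end LocalField

theorem padic_facts (p : ℕ) [Fact p.Prime] (hp : p ≠ 2) (K : Type) [Field K]
    [Algebra ℚ_[p] K] [FiniteDimensional ℚ_[p] K] : (2:K) ≠ 0 ∧ ∃ u π : Kˣ,
    (∀ x : Kˣ, ∃ y : Kˣ, x = y^2 ∨ x = u*y^2 ∨ x = π*y^2 ∨ x = u*π*y^2) ∧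
    (∀ x y z w : K, x^2 - u*y^2 + π*(z^2 - u*w^2) = 0 → x = 0 ∧ y = 0 ∧ z = 0 ∧ w = 0) ∧
    ((∃ y : Kˣ, -1 = y^2) ∨ ((∃ y : Kˣ, -1 = u*y^2) ∧ ∃ r s : K, r^2+s^2 = -1)) := by
  let := spectralNorm.nontriviallyNormedField ℚ_[p] K
  let := spectralNorm.normedAlgebra ℚ_[p] K
  have : IsUltrametricDist K := IsUltrametricDist.isUltrametricDist_of_isNonarchimedean_norm
    (isNonarchimedean_spectralNorm (K := ℚ_[p]) (L := K))
  have : ProperSpace K := FiniteDimensional.proper ℚ_[p] K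
  have h2 : ‖(2:K)‖ = 1 := by
    have h : ‖algebraMap ℚ_[p] K 2‖ = ‖(2:ℚ_[p])‖ := norm_algebraMap' K 2
    rw [map_ofNat] at h
    rw [h]
    have := Padic.norm_intCast_lt_one_iff (p := p) (k := 2)
    have h3 : ¬ ‖((2:ℤ):ℚ_[p])‖ < 1 := by
      rw [this]
      intro hd
      have : p ∣ 2 := by exact_mod_cast hd
      exact hp ((Nat.prime_dvd_prime_iff_eq Fact.out Nat.prime_two).1 this)
    have h4 := Padic.norm_int_le_one (p := p) 2
    push_cast at h3 h4
    exact le_antisymm h4 (not_lt.1 h3)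
  refine ⟨by intro h; simp [h] at h2, lf_facts h2⟩

end PieceOne


section QuadBasics
variable {K : Type} [Field K]
variable {M M' M'' N N' : Type} [AddCommGroup M] [Module K M] [AddCommGroup M'] [Module K M']
  [AddCommGroup M''] [Module K M''] [AddCommGroup N] [Module K N] [AddCommGroup N'] [Module K N']

theorem QIsom.refl (Q : QuadraticForm K M) : QIsom Q Q := ⟨LinearEquiv.refl K M, fun _ => rfl⟩
theorem QIsom.symm {Q : QuadraticForm K M} {Q' : QuadraticForm K M'} (h : QIsom Q Q') :
    QIsom Q' Q := by
  obtain ⟨φ, hφ⟩ := h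
  exact ⟨φ.symm, fun x => by rw [← hφ, φ.apply_symm_apply]⟩
theorem QIsom.trans {Q : QuadraticForm K M} {Q' : QuadraticForm K M'} {Q'' : QuadraticForm K M''}
    (h : QIsom Q Q') (h' : QIsom Q' Q'') : QIsom Q Q'' := by
  obtain ⟨φ, hφ⟩ := h
  obtain ⟨ψ, hψ⟩ := h'
  exact ⟨φ.trans ψ, fun x => by simp [hφ, hψ]⟩
theorem QIsom.prod {Q : QuadraticForm K M} {Q' : QuadraticForm K M'} {P : QuadraticForm K N}
    {P' : QuadraticForm K N'} (h : QIsom Q Q') (h' : QIsom P P') : QIsom (Q.prod P) (Q'.prod P') := by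
  obtain ⟨φ, hφ⟩ := h
  obtain ⟨ψ, hψ⟩ := h'
  exact ⟨φ.prodCongr ψ, fun x => by simp [hφ, hψ]⟩

theorem QIsom.finrank {Q : QuadraticForm K M} {Q' : QuadraticForm K M'} (h : QIsom Q Q') :
    Module.finrank K M = Module.finrank K M' := by
  obtain ⟨φ, hφ⟩ := h
  exact φ.finrank_eq

theorem QIsom.aniso {Q : QuadraticForm K M} {Q' : QuadraticForm K M'} (h : QIsom Q Q')
    (ha : Q.Anisotropic) : Q'.Anisotropic := by
  obtain ⟨φ, hφ⟩ := h.symm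
  intro x hx
  have := ha (φ x) (by rw [hφ, hx])
  simpa using this

theorem QIsom.polar {Q : QuadraticForm K M} {Q' : QuadraticForm K M'} {φ : M ≃ₗ[K] M'}
    (h : ∀ x, Q' (φ x) = Q x) (x y : M) :
    QuadraticMap.polar Q' (φ x) (φ y) = QuadraticMap.polar Q x y := by
  simp [QuadraticMap.polar, ← map_add, h]

theorem QIsom.nondeg {Q : QuadraticForm K M} {Q' : QuadraticForm K M'} (h : QIsom Q Q')
    (ha : QNondeg Q) : QNondeg Q' := by
  obtain ⟨φ, hφ⟩ := h
  intro x hx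
  have := ha (φ.symm x) (fun w => by
    rw [← QIsom.polar hφ, φ.apply_symm_apply]; exact hx _)
  simpa using this

theorem quad_sub_smul (Q : QuadraticForm K M) (x v : M) (c : K) :
    Q (x - c • v) = Q x - c * QuadraticMap.polar Q x v + c * c * Q v := by
  have h := QuadraticMap.polar_smul_right Q (-c) x v
  unfold QuadraticMap.polar at *
  rw [sub_eq_add_neg, ← neg_smul]
  rw [QuadraticMap.map_smul] at h
  simp only [smul_eq_mul] at h
  linear_combination h

/-- The reflection in an anisotropic vector. -/
noncomputable def reflL (Q : QuadraticForm K M) (v : M) : M →ₗ[K] M :=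
  LinearMap.id - ((Q v)⁻¹ • (Q.polarBilin v)).smulRight v

theorem reflL_apply (Q : QuadraticForm K M) (v x : M) :
    reflL Q v x = x - ((Q v)⁻¹ * QuadraticMap.polar Q x v) • v := by
  simp [reflL, QuadraticMap.polar_comm]

theorem reflL_quad (Q : QuadraticForm K M) (v x : M) (hv : Q v ≠ 0) : Q (reflL Q v x) = Q x := by
  rw [reflL_apply, quad_sub_smul]; field_simp; ring

theorem reflL_invol (Q : QuadraticForm K M) (v x : M) (hv : Q v ≠ 0) :
    reflL Q v (reflL Q v x) = x := by
  rw [reflL_apply, reflL_apply, sub_sub, ← add_smul]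
  have : QuadraticMap.polar Q (x - ((Q v)⁻¹ * QuadraticMap.polar Q x v) • v) v =
     - QuadraticMap.polar Q x v := by
    rw [QuadraticMap.polar_sub_left, QuadraticMap.polar_smul_left, QuadraticMap.polar_self]
    simp only [smul_eq_mul]
    field_simp; simp only [nsmul_eq_mul]; push_cast; ring
  rw [this]
  have e : (Q v)⁻¹ * QuadraticMap.polar Q x v + (Q v)⁻¹ * -QuadraticMap.polar Q x v = 0 := by ring
  rw [e]; simp

theorem exists_isom_move (h2 : (2:K) ≠ 0) (Q : QuadraticForm K M) (e f : M) (he : Q e ≠ 0) (hf : Q f = Q e) :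
    ∃ σ : M ≃ₗ[K] M, (∀ x, Q (σ x) = Q x) ∧ σ f = e := by
  by_cases h : Q (f - e) = 0
  · have h4 : Q (f + e) ≠ 0 := by
      intro h0
      have h1 := quad_sub_smul Q f e 1
      rw [one_smul, h, hf] at h1
      have h3 : Q (f + e) = Q f + Q e + QuadraticMap.polar Q f e := by
        simp [QuadraticMap.polar]
      rw [h0, hf] at h3
      have : (2:K)*2 * Q e = 0 := by linear_combination -h1 - h3
      simp [h2, he] at this
    refine ⟨(LinearEquiv.ofInvolutive (reflL Q (f+e)) (fun x => reflL_invol Q _ x h4)).trans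
      (LinearEquiv.neg K), ?_, ?_⟩
    · intro x
      change Q (-(reflL Q (f+e) x)) = Q x
      rw [QuadraticMap.map_neg, reflL_quad _ _ _ h4]
    · change -(reflL Q (f+e) f) = e
      rw [reflL_apply]
      have : QuadraticMap.polar Q f (f+e) = Q (f+e) := by
        rw [QuadraticMap.polar_add_right, QuadraticMap.polar_self]
        simp [QuadraticMap.polar, hf]; ring
      rw [this, inv_mul_cancel₀ h4]; simp
  · refine ⟨(LinearEquiv.ofInvolutive (reflL Q (f-e)) (fun x => reflL_invol Q _ x h)), ?_, ?_⟩
    · intro x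
      exact reflL_quad _ _ _ h
    · change (reflL Q (f-e) f) = e
      rw [reflL_apply]
      have : QuadraticMap.polar Q f (f-e) = Q (f-e) := by
        have h1 := quad_sub_smul Q f e 1
        rw [one_smul] at h1
        rw [QuadraticMap.polar_sub_right, QuadraticMap.polar_self, h1, hf]
        simp; ring
      rw [this, inv_mul_cancel₀ h]; simp

/-- one-dimensional form -/
noncomputable def one1 (a : K) : QuadraticForm K K := a • QuadraticMap.sq

theorem one1_apply (a x : K) : one1 a x = a * (x * x) := by simp [one1]

theorem witt_cancel_one (h2 : (2:K) ≠ 0) (a : K) (ha : a ≠ 0) (Q : QuadraticForm K M)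
    (Q' : QuadraticForm K M') (h : QIsom ((one1 a).prod Q) ((one1 a).prod Q')) : QIsom Q Q' := by
  obtain ⟨φ, hφ⟩ := h
  obtain ⟨σ, hσ, hσe⟩ := exists_isom_move h2 ((one1 a).prod Q') ((1:K), (0:M')) (φ (1,0))
    (by simp [one1_apply, ha]) (by rw [hφ]; simp [one1_apply])
  set ψ := φ.trans σ with hψ
  have hψQ : ∀ x, ((one1 a).prod Q') (ψ x) = ((one1 a).prod Q) x := fun x => by
    simp only [hψ, LinearEquiv.trans_apply, hσ, hφ]
  have hψe : ψ (1,0) = (1,0) := hσe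
  have hker : ∀ v : M, (ψ (0, v)).1 = 0 := by
    intro v
    have := QIsom.polar hψQ (1,0) (0,v)
    rw [hψe] at this
    simp [QuadraticMap.polar, one1_apply] at this
    have h3 : 2 * a * (ψ (0,v)).1 = 0 := by linear_combination this
    simpa [h2, ha] using h3
  have hψe' : ψ.symm (1,0) = (1,0) := by rw [LinearEquiv.symm_apply_eq, hψe]
  have hker' : ∀ v : M', (ψ.symm (0, v)).1 = 0 := by
    intro v
    have hψQ' : ∀ x, ((one1 a).prod Q) (ψ.symm x) = ((one1 a).prod Q') x := fun x => by
      rw [← hψQ, ψ.apply_symm_apply]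
    have := QIsom.polar hψQ' (1,0) (0,v)
    rw [hψe'] at this
    simp [QuadraticMap.polar, one1_apply] at this
    have h3 : 2 * a * (ψ.symm (0,v)).1 = 0 := by linear_combination this
    simpa [h2, ha] using h3
  refine ⟨LinearEquiv.ofLinear
    ((LinearMap.snd K K M').comp (ψ.toLinearMap.comp (LinearMap.inr K K M)))
    ((LinearMap.snd K K M).comp (ψ.symm.toLinearMap.comp (LinearMap.inr K K M'))) ?_ ?_, ?_⟩
  · ext v
    simp only [LinearMap.comp_apply, LinearMap.inr_apply, LinearMap.snd_apply, LinearEquiv.coe_coe,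
      LinearMap.id_apply]
    have : ((0:K), (ψ.symm (0, v)).2) = ψ.symm (0,v) := Prod.ext (hker' v).symm rfl
    rw [this]; simp
  · ext v
    simp only [LinearMap.comp_apply, LinearMap.inr_apply, LinearMap.snd_apply, LinearEquiv.coe_coe,
      LinearMap.id_apply]
    have : ((0:K), (ψ (0, v)).2) = ψ (0,v) := Prod.ext (hker v).symm rfl
    rw [this]; simp
  · intro v
    have h1 := hψQ (0,v)
    have : ψ (0,v) = ((0:K), (ψ (0, v)).2) := Prod.ext (hker v) rfl
    rw [this] at h1
    simpa [one1_apply] using h1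
end QuadBasics

section MultisetForms
variable {K : Type} [Field K]
variable {M M' M'' N N' : Type} [AddCommGroup M] [Module K M] [AddCommGroup M'] [Module K M']
  [AddCommGroup M''] [Module K M''] [AddCommGroup N] [Module K N] [AddCommGroup N'] [Module K N']

theorem QIsom.prod_assoc (Q : QuadraticForm K M) (Q' : QuadraticForm K M') (Q'' : QuadraticForm K M'') :
    QIsom ((Q.prod Q').prod Q'') (Q.prod (Q'.prod Q'')) :=
  ⟨LinearEquiv.prodAssoc K M M' M'', fun x => by simp [add_assoc]⟩
theorem QIsom.prod_comm (Q : QuadraticForm K M) (Q' : QuadraticForm K M') :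
    QIsom (Q.prod Q') (Q'.prod Q) :=
  ⟨LinearEquiv.prodComm K M M', fun x => by simp [add_comm]⟩
theorem QIsom.prod_sub [Subsingleton M] (Q : QuadraticForm K M) (Q' : QuadraticForm K M') :
    QIsom (Q.prod Q') Q' :=
  ⟨LinearEquiv.ofLinear (LinearMap.snd K M M') (LinearMap.inr K M M') (by ext; simp)
    (by ext x <;> simp [Subsingleton.elim _ (0:M)]), fun x => by
      simp [Subsingleton.elim x.1 (0:M)]⟩

/-- the diagonal form with the given list of coefficients -/
noncomputable def lf (l : List Kˣ) : QuadraticForm K (Fin l.length → K) :=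
  QuadraticMap.weightedSumSquares K (fun i => ((l.get i : Kˣ) : K))

theorem wss_succ {k : ℕ} (w : Fin (k+1) → K) :
    QIsom (QuadraticMap.weightedSumSquares K w) ((one1 (w 0)).prod
      (QuadraticMap.weightedSumSquares K (fun i : Fin k => w i.succ))) := by
  refine ⟨(Fin.consLinearEquiv K (fun _ : Fin (k+1) => K)).symm, ?_⟩
  intro x
  simp [QuadraticMap.weightedSumSquares_apply, Fin.sum_univ_succ, one1_apply]
  rfl

theorem lf_cons (a : Kˣ) (l : List Kˣ) : QIsom (lf (a :: l)) ((one1 (a:K)).prod (lf l)) :=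
  wss_succ (k := l.length) (fun i => (((a::l).get i : Kˣ) : K))

theorem lf_perm {l l' : List Kˣ} (h : l.Perm l') : QIsom (lf l) (lf l') := by
  induction h with
  | nil => exact QIsom.refl _
  | cons x _ ih => exact (lf_cons _ _).trans (((QIsom.refl _).prod ih).trans (lf_cons _ _).symm)
  | swap x y l =>
    refine (lf_cons _ _).trans ((((QIsom.refl _).prod (lf_cons _ _)).trans ?_).trans (lf_cons _ _).symm)
    refine (QIsom.trans ?_ ((QIsom.refl _).prod (lf_cons _ _).symm))
    exact (QIsom.prod_assoc _ _ _).symm.trans (((QIsom.prod_comm _ _).prod (QIsom.refl _)).trans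
      (QIsom.prod_assoc _ _ _))
  | trans _ _ h1 h2 => exact h1.trans h2

noncomputable def mf (s : Multiset Kˣ) : QuadraticForm K (Fin s.toList.length → K) := lf s.toList

theorem mf_coe (l : List Kˣ) : QIsom (mf (l : Multiset Kˣ)) (lf l) :=
  lf_perm (Multiset.coe_eq_coe.mp (Multiset.coe_toList _))

theorem mf_cons (a : Kˣ) (s : Multiset Kˣ) : QIsom (mf (a ::ₘ s)) ((one1 (a:K)).prod (mf s)) :=
  (lf_perm (l' := a :: s.toList) (Multiset.coe_eq_coe.mp (by rw [Multiset.coe_toList, ← Multiset.cons_coe, Multiset.coe_toList]))).trans (lf_cons _ _)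

theorem mf_zero_prod (Q : QuadraticForm K M) : QIsom ((mf (0 : Multiset Kˣ)).prod Q) Q := by
  haveI : IsEmpty (Fin (Multiset.toList (0 : Multiset Kˣ)).length) := by
    simp only [Multiset.toList_zero, List.length_nil]; infer_instance
  exact QIsom.prod_sub _ _

theorem mf_add (s t : Multiset Kˣ) : QIsom (mf (s + t)) ((mf s).prod (mf t)) := by
  induction s using Multiset.induction with
  | empty => rw [zero_add]; exact (mf_zero_prod _).symm
  | cons a s ih =>
    rw [Multiset.cons_add]
    exact (mf_cons _ _).trans (((QIsom.refl _).prod ih).trans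
      ((QIsom.prod_assoc _ _ _).symm.trans ((mf_cons _ _).symm.prod (QIsom.refl _))))

theorem mf_finrank (s : Multiset Kˣ) : Module.finrank K (Fin s.toList.length → K) = s.card := by
  simp

theorem mf_card {s t : Multiset Kˣ} (h : QIsom (mf s) (mf t)) : s.card = t.card := by
  have := h.finrank; simpa using this

theorem mf_cancel (h2 : (2:K) ≠ 0) (s t u : Multiset Kˣ) (h : QIsom (mf (s+u)) (mf (t+u))) :
    QIsom (mf s) (mf t) := by
  induction u using Multiset.induction with
  | empty => rw [add_zero, add_zero] at h; exact h
  | cons a u ih =>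
    apply ih
    rw [Multiset.add_cons, Multiset.add_cons] at h
    exact witt_cancel_one h2 a a.ne_zero _ _ ((mf_cons _ _).symm.trans (h.trans (mf_cons _ _)))

theorem mf_add_congr {s t s' t' : Multiset Kˣ} (h : QIsom (mf s) (mf t)) (h' : QIsom (mf s') (mf t')) :
    QIsom (mf (s+s')) (mf (t+t')) :=
  (mf_add _ _).trans ((h.prod h').trans (mf_add _ _).symm)

theorem mf_le_aniso {s t : Multiset Kˣ} (h : s ≤ t) (ha : (mf t).Anisotropic) : (mf s).Anisotropic := by
  obtain ⟨u, rfl⟩ := Multiset.le_iff_exists_add.mp h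
  have := (mf_add s u).aniso ha
  intro x hx
  have := this (x, 0) (by simp [hx])
  exact (Prod.mk.inj this).1

theorem mf_one (a : Kˣ) : QIsom (mf {a}) (one1 (a:K)) :=
  (mf_cons a 0).trans ((QIsom.prod_comm _ _).trans (mf_zero_prod _))
theorem mf_two (a b : Kˣ) : QIsom (mf {a, b}) ((one1 (a:K)).prod (one1 (b:K))) :=
  (mf_cons a {b}).trans ((QIsom.refl _).prod (mf_one b))

theorem mf_sq (a b : Kˣ) : QIsom (mf {a}) (mf {a * b^2}) := by
  refine (mf_one a).trans (QIsom.trans ?_ (mf_one _).symm)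
  refine ⟨LinearEquiv.smulOfUnit b⁻¹, fun x => ?_⟩
  simp [one1_apply, LinearEquiv.smulOfUnit, Units.smul_def]
  have := b.ne_zero
  field_simp

theorem hyp_isom (h2 : (2:K) ≠ 0) (a : Kˣ) : QIsom (HypForm K) ((one1 (a:K)).prod (one1 ((-a : Kˣ):K))) := by
  have ha := a.ne_zero
  refine ⟨LinearEquiv.ofLinear
    ((((a:K)⁻¹ * 2⁻¹) • LinearMap.fst K K K + (2⁻¹:K) • LinearMap.snd K K K).prod
      (((a:K)⁻¹ * 2⁻¹) • LinearMap.fst K K K - (2⁻¹:K) • LinearMap.snd K K K))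
    (((a:K) • LinearMap.fst K K K + (a:K) • LinearMap.snd K K K).prod
      (LinearMap.fst K K K - LinearMap.snd K K K)) ?_ ?_, ?_⟩
  · ext <;> simp <;> field_simp <;> norm_num
  · ext <;> simp <;> field_simp <;> norm_num
  · intro x
    simp [one1_apply, HypForm]
    field_simp
    ring

theorem mf_hyp (h2 : (2:K) ≠ 0) (a : Kˣ) : QIsom (HypForm K) (mf {a, -a}) :=
  (hyp_isom h2 a).trans (mf_two _ _).symm

/-- hyperbolic multiset -/
def HH (a : ℕ) : Multiset Kˣ := a • {1, -1}

theorem hypSum_mf (h2 : (2:K) ≠ 0) (a : ℕ) : QIsom (HypSum K a) (mf (HH a)) := by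
  induction a with
  | zero =>
    have : QIsom ((mf (0 : Multiset Kˣ)).prod (HypSum K 0)) (HypSum K 0) := mf_zero_prod _
    refine this.symm.trans ((QIsom.prod_comm _ _).trans ?_)
    rw [HH, zero_smul]
    exact QIsom.prod_sub _ _
  | succ a ih =>
    have h1 : QIsom (HypSum K (a+1)) ((HypForm K).prod (HypSum K a)) := by
      refine ⟨(Fin.consLinearEquiv K (fun _ : Fin (a+1) => K × K)).symm, fun x => ?_⟩
      simp [HypSum, Fin.sum_univ_succ, QuadraticMap.pi_apply]
      rfl
    refine h1.trans (((mf_hyp h2 1).prod ih).trans ((mf_add _ _).symm.trans ?_))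
    rw [HH, HH, succ_nsmul, add_comm]
    exact QIsom.refl _

theorem nondeg_mf (h2 : (2:K) ≠ 0) [FiniteDimensional K M] (Q : QuadraticForm K M) (hQ : QNondeg Q) :
    ∃ s : Multiset Kˣ, QIsom Q (mf s) := by
  haveI : Invertible (2:K) := invertibleOfNonzero h2
  have hh := QuadraticForm.equivalent_weightedSumSquares_units_of_nondegenerate' Q
    (by
      intro x hx
      apply hQ
      intro w
      have h := hx w
      rw [QuadraticMap.associated_apply] at h
      have h3 : (2:K) * (⅟ (2:K) • (Q (x + w) - Q x - Q w)) = 0 := by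
        simpa using congrArg (fun z => (2:K) * z) h
      simpa [QuadraticMap.polar, h2] using h3)
  obtain ⟨w, ⟨e⟩⟩ := hh
  have key : ∀ (k : ℕ) (w : Fin k → Kˣ), ∃ s : Multiset Kˣ,
      QIsom (QuadraticMap.weightedSumSquares K (fun i => (w i : K))) (mf s) := by
    intro k
    induction k with
    | zero =>
      intro w
      refine ⟨0, QIsom.trans ?_ (QIsom.prod_sub (QuadraticMap.weightedSumSquares K (fun i => (w i : K))) _)⟩
      exact ((QIsom.prod_comm _ _).trans (mf_zero_prod _)).symm
    | succ k ih =>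
      intro w
      obtain ⟨s, hs⟩ := ih (fun i => w i.succ)
      exact ⟨w 0 ::ₘ s, (wss_succ _).trans (((QIsom.refl _).prod hs).trans (mf_cons _ _).symm)⟩
  obtain ⟨s, hs⟩ := key _ w
  refine ⟨s, QIsom.trans ⟨e.toLinearEquiv, fun x => ?_⟩ hs⟩
  exact e.map_app x

theorem HH_add (a b : ℕ) : (HH (a+b) : Multiset Kˣ) = HH a + HH b := add_smul _ _ _
theorem HH_card (a : ℕ) : (HH a : Multiset Kˣ).card = 2 * a := by simp [HH, mul_comm]

theorem HH_not_aniso (h2 : (2:K) ≠ 0) (s : Multiset Kˣ) (a : ℕ) (h : (mf (s + HH a)).Anisotropic) : a = 0 := by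
  by_contra ha
  obtain ⟨b, rfl⟩ := Nat.exists_eq_succ_of_ne_zero ha
  have h1 : (HH 1 : Multiset Kˣ) ≤ s + HH (b+1) := by
    rw [HH_add, ← add_assoc]; exact Multiset.le_add_left _ _
  have h2' := mf_le_aniso h1 h
  simp only [HH, one_smul] at h2'
  have h3 := (mf_hyp h2 1).symm.aniso h2'
  have := h3 (1, 0) (by simp [HypForm])
  simpa using this

/-- Witt equivalence on multisets -/
def WE (s t : Multiset Kˣ) : Prop := ∃ a b : ℕ, QIsom (mf (s + HH a)) (mf (t + HH b))

theorem WE.of_isom {s t : Multiset Kˣ} (h : QIsom (mf s) (mf t)) : WE s t :=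
  ⟨0, 0, by rw [HH, zero_smul, add_zero, add_zero]; exact h⟩
theorem WE.refl (s : Multiset Kˣ) : WE s s := WE.of_isom (QIsom.refl _)
theorem WE.symm {s t : Multiset Kˣ} (h : WE s t) : WE t s := by
  obtain ⟨a, b, h⟩ := h
  exact ⟨b, a, h.symm⟩
theorem WE.trans {s t r : Multiset Kˣ} (h : WE s t) (h' : WE t r) : WE s r := by
  obtain ⟨a, b, h⟩ := h
  obtain ⟨a', b', h'⟩ := h'
  refine ⟨a + a', b + b', ?_⟩
  rw [HH_add, HH_add, ← add_assoc]
  refine (mf_add_congr (s' := HH a') (t' := HH a') h (QIsom.refl _)).trans ?_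
  have := (mf_add_congr (s' := HH b) (t' := HH b) h' (QIsom.refl _))
  rw [show t + HH b + HH a' = t + HH a' + HH b by abel, show r + (HH b + HH b') = r + HH b' + HH b by abel]
  exact this
theorem WE.add {s t s' t' : Multiset Kˣ} (h : WE s t) (h' : WE s' t') : WE (s + s') (t + t') := by
  obtain ⟨a, b, h⟩ := h
  obtain ⟨a', b', h'⟩ := h'
  refine ⟨a + a', b + b', ?_⟩
  rw [HH_add, HH_add, add_add_add_comm, add_add_add_comm t]
  exact mf_add_congr h h'

theorem WE.hyp (h2 : (2:K) ≠ 0) (a : Kˣ) : WE {a, -a} 0 := by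
  refine ⟨0, 1, ?_⟩
  have := (mf_hyp h2 a).symm.trans (mf_hyp h2 1)
  rw [HH, HH, zero_smul, add_zero, zero_add, one_smul]; exact this

theorem WE.isom (h2 : (2:K) ≠ 0) {s t : Multiset Kˣ} (h : WE s t) (hc : s.card = t.card) : QIsom (mf s) (mf t) := by
  obtain ⟨a, b, h⟩ := h
  have := mf_card h
  simp only [Multiset.card_add, HH_card] at this
  obtain rfl : a = b := by omega
  exact mf_cancel h2 _ _ _ h

theorem WE.aniso_le (h2 : (2:K) ≠ 0) {s t : Multiset Kˣ} (h : WE s t) (ha : (mf t).Anisotropic) :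
    ∃ k, s.card = t.card + 2 * k ∧ QIsom (mf s) (mf (t + HH k)) := by
  obtain ⟨a, b, h⟩ := h
  have hc := mf_card h
  simp only [Multiset.card_add, HH_card] at hc
  rcases le_total a b with hab | hab
  · obtain ⟨k, rfl⟩ := Nat.exists_eq_add_of_le hab
    refine ⟨k, by omega, ?_⟩
    rw [add_comm a k, HH_add, ← add_assoc] at h
    exact mf_cancel h2 _ _ _ h
  · obtain ⟨k, rfl⟩ := Nat.exists_eq_add_of_le hab
    rw [add_comm b k, HH_add, ← add_assoc] at h
    have h' := (mf_cancel h2 _ _ _ h).symm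
    have := HH_not_aniso h2 _ _ (h'.aniso ha)
    subst this
    rw [HH, zero_smul, add_zero] at h'
    refine ⟨0, mf_card h'.symm, ?_⟩
    rw [HH, zero_smul, add_zero]; exact h'.symm

/-- Witt data: computation of the Witt group. -/
structure WD (K : Type) [Field K] (T : Type) [AddCommGroup T] (dd : T → ℕ) where
  two : (2:K) ≠ 0
  cl : Kˣ → T
  we : ∀ s t : Multiset Kˣ, (s.map cl).sum = (t.map cl).sum → WE s t
  rep : ∀ t : T, ∃ s : Multiset Kˣ, s.card = dd t ∧ (s.map cl).sum = t ∧ (mf s).Anisotropic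

namespace WD
variable {T : Type} [AddCommGroup T] {dd : T → ℕ} (D : WD K T dd)

def tot (s : Multiset Kˣ) : T := (s.map D.cl).sum
theorem tot_add (s t : Multiset Kˣ) : D.tot (s + t) = D.tot s + D.tot t := by simp [tot]
theorem tot_cons (a : Kˣ) (t : Multiset Kˣ) : D.tot (a ::ₘ t) = D.cl a + D.tot t := by simp [tot]

theorem eq_of_we {s t : Multiset Kˣ} (h : WE s t) : D.tot s = D.tot t := by
  obtain ⟨t', -, ht', -⟩ := D.rep (- D.tot t)
  obtain ⟨x, -, hx, hxa⟩ := D.rep (D.tot s - D.tot t)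
  have h1 : WE (t + t') 0 := D.we _ _ (by
    change D.tot (t + t') = _
    rw [D.tot_add]; change _ + (t'.map D.cl).sum = _; rw [ht']; simp)
  have h2 : WE x (s + t') := D.we _ _ (by
    change _ = D.tot (s + t')
    rw [hx, D.tot_add]; change _ = _ + (t'.map D.cl).sum; rw [ht']; abel)
  have h3 : WE 0 x := ((h2.trans (h.add (WE.refl t'))).trans h1).symm
  obtain ⟨k, hk, -⟩ := h3.aniso_le D.two hxa
  have : x = 0 := by
    rw [← Multiset.card_eq_zero]; simp at hk; omega
  rw [this] at hx
  simp at hx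
  exact (sub_eq_zero.mp hx.symm)

theorem tot_we_iff {s t : Multiset Kˣ} : WE s t ↔ D.tot s = D.tot t := ⟨D.eq_of_we, D.we s t⟩
theorem cl_neg (a : Kˣ) : D.cl (-a) = - D.cl a := by
  have := D.eq_of_we (WE.hyp D.two a)
  simp [tot] at this
  exact eq_neg_of_add_eq_zero_right this
theorem tot_isom {s t : Multiset Kˣ} (h : QIsom (mf s) (mf t)) : D.tot s = D.tot t :=
  D.eq_of_we (WE.of_isom h)
theorem isom_of {s t : Multiset Kˣ} (hc : s.card = t.card) (h : D.tot s = D.tot t) :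
    QIsom (mf s) (mf t) := (D.we s t h).isom D.two hc
theorem tot_HH (a : ℕ) : D.tot (HH a) = 0 := by
  simp [HH, tot, Multiset.map_nsmul, Multiset.sum_nsmul, cl_neg]

theorem exists_iff (t : T) (m : ℕ) :
    (∃ s : Multiset Kˣ, s.card = m ∧ D.tot s = t) ↔ dd t ≤ m ∧ dd t % 2 = m % 2 := by
  obtain ⟨r, hr, hrt, hra⟩ := D.rep t
  constructor
  · rintro ⟨s, rfl, hs⟩
    obtain ⟨k, hk, -⟩ := (D.we s r (by rw [hrt]; exact hs)).aniso_le D.two hra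
    omega
  · rintro ⟨h1, h2⟩
    refine ⟨r + HH ((m - dd t)/2), ?_, ?_⟩
    · rw [Multiset.card_add, HH_card, hr]; omega
    · rw [D.tot_add, D.tot_HH]; rw [add_zero]; exact hrt

theorem aniso_card {s : Multiset Kˣ} (h : (mf s).Anisotropic) : s.card = dd (D.tot s) := by
  obtain ⟨r, hr, hrt, hra⟩ := D.rep (D.tot s)
  obtain ⟨k, hk, hi⟩ := (D.we s r (by rw [hrt]; rfl)).aniso_le D.two hra
  have := HH_not_aniso D.two _ _ (hi.aniso h)
  omega

/-- class of a form -/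
def HasClass (Q : QuadraticForm K M) (t : T) : Prop := ∃ s : Multiset Kˣ, QIsom Q (mf s) ∧ D.tot s = t

theorem hasClass_unique {Q : QuadraticForm K M} {t t' : T} (h : D.HasClass Q t) (h' : D.HasClass Q t') :
    t = t' := by
  obtain ⟨s, hs, rfl⟩ := h
  obtain ⟨s', hs', rfl⟩ := h'
  exact D.tot_isom (hs.symm.trans hs')
theorem hasClass_exists [FiniteDimensional K M] (Q : QuadraticForm K M) (hQ : QNondeg Q) :
    ∃ t, D.HasClass Q t := by
  obtain ⟨s, hs⟩ := nondeg_mf D.two Q hQ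
  exact ⟨_, s, hs, rfl⟩
theorem HasClass.congr {Q : QuadraticForm K M} {Q' : QuadraticForm K M'} {t : T} (h : D.HasClass Q t)
    (h' : QIsom Q Q') : D.HasClass Q' t := by
  obtain ⟨s, hs, rfl⟩ := h
  exact ⟨s, h'.symm.trans hs, rfl⟩
theorem HasClass.prod {Q : QuadraticForm K M} {Q' : QuadraticForm K M'} {t t' : T} (h : D.HasClass Q t)
    (h' : D.HasClass Q' t') : D.HasClass (Q.prod Q') (t + t') := by
  obtain ⟨s, hs, rfl⟩ := h
  obtain ⟨s', hs', rfl⟩ := h'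
  exact ⟨s + s', (hs.prod hs').trans (mf_add _ _).symm, D.tot_add _ _⟩
theorem hasClass_hyp (a : ℕ) : D.HasClass (HypSum K a) 0 := ⟨HH a, hypSum_mf D.two a, D.tot_HH a⟩
theorem HasClass.isom {Q : QuadraticForm K M} {Q' : QuadraticForm K M'} {t : T} (h : D.HasClass Q t)
    (h' : D.HasClass Q' t) (hr : Module.finrank K M = Module.finrank K M') : QIsom Q Q' := by
  obtain ⟨s, hs, hst⟩ := h
  obtain ⟨s', hs', rfl⟩ := h'
  refine hs.trans ((D.isom_of ?_ hst).trans hs'.symm)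
  have h1 := hs.finrank
  have h2 := hs'.finrank
  simp at h1 h2
  omega
theorem mf_neg (s : Multiset Kˣ) : QIsom (-mf s) (mf (s.map (fun x => -x))) := by
  induction s using Multiset.induction with
  | empty =>
    rw [Multiset.map_zero]
    refine ⟨LinearEquiv.refl K _, fun x => ?_⟩
    haveI : IsEmpty (Fin (Multiset.toList (0 : Multiset Kˣ)).length) := by
      simp only [Multiset.toList_zero, List.length_nil]; infer_instance
    rw [Subsingleton.elim x 0]; simp
  | cons a s ih =>
    rw [Multiset.map_cons]
    refine QIsom.trans ?_ (mf_cons _ _).symm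
    obtain ⟨φ, hφ⟩ := mf_cons a s
    refine QIsom.trans ?_ ((QIsom.refl _).prod ih)
    refine ⟨φ, fun x => ?_⟩
    rw [QuadraticMap.neg_apply, ← hφ x]
    simp [one1_apply]; ring
theorem HasClass.neg {Q : QuadraticForm K M} {t : T} (h : D.HasClass Q t) : D.HasClass (-Q) (-t) := by
  obtain ⟨s, ⟨φ, hφ⟩, rfl⟩ := h
  refine ⟨s.map (fun x => -x), QIsom.trans ⟨φ, fun x => ?_⟩ (mf_neg s), ?_⟩
  · simp [hφ]
  · simp [tot, cl_neg, Multiset.map_map]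
theorem aniso_hasClass [FiniteDimensional K M] {Q : QuadraticForm K M} {t : T} (h : D.HasClass Q t)
    (ha : Q.Anisotropic) : Module.finrank K M = dd t := by
  obtain ⟨s, hs, rfl⟩ := h
  rw [← D.aniso_card (hs.aniso ha), hs.finrank]; simp
theorem hasClass_range (m : ℕ) (W : Type) [AddCommGroup W] [Module K W] [FiniteDimensional K W] (hW : Module.finrank K W = m) (t : T) :
   (∃ Q : QuadraticForm K W, QNondeg Q ∧ D.HasClass Q t) ↔ dd t ≤ m ∧ dd t % 2 = m % 2 := by
  rw [← D.exists_iff]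
  constructor
  · rintro ⟨Q, hQ, s, hs, rfl⟩
    refine ⟨s, ?_, rfl⟩
    have := hs.finrank
    simp at this; omega
  · rintro ⟨s, hs, rfl⟩
    have e : W ≃ₗ[K] (Fin s.toList.length → K) := LinearEquiv.ofFinrankEq _ _ (by simp [hW, hs])
    have hi : QIsom ((mf s).comp e.toLinearMap) (mf s) := ⟨e, fun x => rfl⟩
    refine ⟨(mf s).comp e.toLinearMap, hi.symm.nondeg ?_, s, hi, rfl⟩
    intro v hv
    ext i
    have := hv (Pi.single i 1)
    have e1 : ∀ x : Fin s.toList.length → K, mf s x = ∑ i, ((s.toList.get i : Kˣ) : K) * (x i * x i) := fun x => by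
      simp [mf, lf, QuadraticMap.weightedSumSquares_apply, Units.smul_def]
    rw [QuadraticMap.polar, e1, e1, e1, ← Finset.sum_sub_distrib, ← Finset.sum_sub_distrib,
      Finset.sum_eq_single i] at this
    · simp at this
      have h3 : 2 * ((s.toList.get i : Kˣ) : K) * v i = 0 := by
        simp only [List.get_eq_getElem]; linear_combination this
      simpa [D.two] using h3
    · intro j _ hj; simp [hj]
    · simp
end WD
end MultisetForms

section WDConstruct
variable {K : Type} [Field K]

abbrev T1 : Type := ZMod 2 × ZMod 2 × ZMod 2 × ZMod 2
abbrev T2 : Type := ZMod 4 × ZMod 4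
def dd1 (t : T1) : ℕ := t.1.val + t.2.1.val + t.2.2.1.val + t.2.2.2.val
def d4 (x : ZMod 4) : ℕ := min x.val (4 - x.val)
def dd2 (t : T2) : ℕ := d4 t.1 + d4 t.2

theorem we_nsmul {s t : Multiset Kˣ} (h : WE s t) (k : ℕ) : WE (k • s) (k • t) := by
  induction k with
  | zero => rw [zero_smul, zero_smul]; exact WE.refl _
  | succ k ih => rw [succ_nsmul, succ_nsmul]; exact ih.add h

theorem we_val_add (m : ℕ) [NeZero m] (g : Multiset Kˣ) (hg : WE (m • g) 0) (a b : ZMod m) :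
    WE (a.val • g + b.val • g) ((a + b).val • g) := by
  rw [← add_smul, ZMod.val_add]
  have h1 : a.val + b.val = (a.val + b.val) % m + (a.val + b.val) / m * m := by
    rw [mul_comm]; exact (Nat.mod_add_div _ _).symm
  have h2 : WE (((a.val + b.val) / m) • (m • g)) 0 := by
    have := we_nsmul hg ((a.val + b.val) / m)
    rw [smul_zero] at this; exact this
  rw [smul_smul] at h2
  have h3 := (WE.refl (((a.val + b.val) % m) • g)).add h2
  rw [← add_smul, ← h1, add_zero] at h3
  exact h3

theorem wd_of_phi {T : Type} [AddCommGroup T] {dd : T → ℕ} (h2 : (2:K) ≠ 0) (phi : T → Multiset Kˣ)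
    (h0 : phi 0 = 0)
    (hadd : ∀ a b, WE (phi a + phi b) (phi (a + b)))
    (hcl : ∀ a, ∃ t, WE {a} (phi t)) (rep : T → Multiset Kˣ) (hrep : ∀ t, WE (rep t) (phi t))
    (hcard : ∀ t, (rep t).card = dd t) (han : ∀ t, (mf (rep t)).Anisotropic)
    (hdd : ∀ t, dd t = 0 → t = 0) : Nonempty (WD K T dd) := by
  choose cl hcl using hcl
  have key : ∀ s : Multiset Kˣ, WE s (phi (s.map cl).sum) := by
    intro s
    induction s using Multiset.induction with
    | empty =>
      rw [Multiset.map_zero, Multiset.sum_zero, h0]; exact WE.refl _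
    | cons a s ih =>
      rw [Multiset.map_cons, Multiset.sum_cons, ← Multiset.singleton_add]
      exact ((hcl a).add ih).trans (hadd _ _)
  have hinj : ∀ a b, WE (phi a) (phi b) → a = b := by
    intro a b h
    have h1 := (hadd a (-b)).symm.trans ((h.add (WE.refl (phi (-b)))).trans (hadd b (-b)))
    rw [add_neg_cancel, h0] at h1
    obtain ⟨k, hk, -⟩ := ((hrep _).trans h1).symm.aniso_le h2 (han _)
    have h3 : dd (a + -b) = 0 := by rw [← hcard]; simp at hk; omega
    exact add_neg_eq_zero.mp (hdd _ h3)
  refine ⟨⟨h2, cl, fun s t h => (key s).trans (h ▸ (key t).symm), fun t => ⟨rep t, hcard t, ?_, han t⟩⟩⟩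
  exact hinj _ _ ((key _).symm.trans (hrep t))

theorem mf_four_aniso (a b c d : Kˣ) (h : ∀ x y z w : K, a*x^2 + b*y^2 + c * z^2 + d * w^2 = 0 → x = 0 ∧ y = 0 ∧ z = 0 ∧ w = 0) :
    (mf ({a, b, c, d} : Multiset Kˣ)).Anisotropic := by
  have h1 : QIsom (mf ({a, b, c, d} : Multiset Kˣ)) ((one1 (a:K)).prod ((one1 (b:K)).prod ((one1 (c:K)).prod (one1 (d:K))))) :=
    (mf_cons a _).trans ((QIsom.refl _).prod ((mf_cons b _).trans ((QIsom.refl _).prod (mf_two c d))))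
  refine h1.symm.aniso ?_
  rintro ⟨x, y, z, w⟩ hx
  simp [one1_apply] at hx
  obtain ⟨rfl, rfl, rfl, rfl⟩ := h x y z w (by linear_combination hx)
  rfl

theorem we_sq (a b : Kˣ) : WE ({a * b^2} : Multiset Kˣ) {a} := WE.of_isom (mf_sq a b).symm

theorem wd_case1 (h2 : (2:K) ≠ 0) (u π : Kˣ)
    (hc : ∀ x : Kˣ, ∃ y : Kˣ, x = y^2 ∨ x = u*y^2 ∨ x = π*y^2 ∨ x = u*π*y^2)
    (han : ∀ x y z w : K, x^2 - u*y^2 + π*(z^2 - u*w^2) = 0 → x = 0 ∧ y = 0 ∧ z = 0 ∧ w = 0)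
    (hm : ∃ y : Kˣ, -1 = y^2) : Nonempty (WD K T1 dd1) := by
  obtain ⟨i, hi⟩ := hm
  have hneg : ∀ a : Kˣ, WE ({a, a} : Multiset Kˣ) 0 := by
    intro a
    refine WE.trans ?_ (WE.hyp h2 a)
    rw [Multiset.insert_eq_cons, Multiset.insert_eq_cons, ← Multiset.singleton_add, ← Multiset.singleton_add a {-a}]
    refine (WE.refl _).add ?_
    have : -a = a * i^2 := by rw [← hi]; simp
    rw [this]; exact (we_sq a i).symm
  have hneg2 : ∀ a : Kˣ, WE (2 • ({a} : Multiset Kˣ)) 0 := by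
    intro a
    rw [two_smul, Multiset.singleton_add]; exact hneg a
  let phi : T1 → Multiset Kˣ := fun t => t.1.val • {1} + (t.2.1.val • {u} + (t.2.2.1.val • {π} + t.2.2.2.val • {u * π}))
  have hcl : ∀ x : Kˣ, ∃ t : T1, WE {x} (phi t) := by
    intro x
    obtain ⟨y, hy | hy | hy | hy⟩ := hc x
    · refine ⟨(1,0,0,0), ?_⟩
      have := we_sq 1 y
      rw [one_mul, ← hy] at this
      simpa [phi, ZMod.val_one] using this
    · refine ⟨(0,1,0,0), ?_⟩
      have := we_sq u y
      rw [← hy] at this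
      simpa [phi, ZMod.val_one] using this
    · refine ⟨(0,0,1,0), ?_⟩
      have := we_sq π y
      rw [← hy] at this
      simpa [phi, ZMod.val_one] using this
    · refine ⟨(0,0,0,1), ?_⟩
      have := we_sq (u * π) y
      rw [← hy] at this
      simpa [phi, ZMod.val_one] using this
  have hphi0 : phi 0 = 0 := by simp [phi]
  have hadd : ∀ a b, WE (phi a + phi b) (phi (a + b)) := by
    intro a b
    have e : phi a + phi b = (a.1.val • {1} + b.1.val • {1}) + ((a.2.1.val • {u} + b.2.1.val • {u}) +
      ((a.2.2.1.val • {π} + b.2.2.1.val • {π}) + (a.2.2.2.val • {u * π} + b.2.2.2.val • {u * π}))) := by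
      simp only [phi]; abel
    rw [e]
    exact (we_val_add 2 _ (hneg2 _) _ _).add ((we_val_add 2 _ (hneg2 _) _ _).add
      ((we_val_add 2 _ (hneg2 _) _ _).add (we_val_add 2 _ (hneg2 _) _ _)))
  have hfull : (mf ({1, u, π, u*π} : Multiset Kˣ)).Anisotropic := by
    apply mf_four_aniso
    intro x y z w h
    have hi' : (i:K)^2 = -1 := by rw [← Units.val_pow_eq_pow_val, ← hi]; simp
    have hne := i.ne_zero
    obtain ⟨h1, h2, h3, h4⟩ := han x (i*y) z (i*w) (by
      simp only [Units.val_one, Units.val_mul] at h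
      linear_combination h - (u * y^2 + π * u * w^2) * hi')
    simp [hne] at h2 h4
    exact ⟨h1, h2, h3, h4⟩
  have hle : ∀ t, phi t ≤ {1, u, π, u*π} := by
    intro t
    have h1 : ∀ (z : ZMod 2) (g : Kˣ), z.val • ({g} : Multiset Kˣ) ≤ {g} := by
      intro z g
      have : z.val < 2 := z.val_lt
      interval_cases z.val <;> simp
    have : ({1, u, π, u*π} : Multiset Kˣ) = {1} + ({u} + ({π} + {u*π})) := rfl
    rw [this]
    exact add_le_add (h1 _ _) (add_le_add (h1 _ _) (add_le_add (h1 _ _) (h1 _ _)))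
  refine wd_of_phi h2 phi hphi0 hadd hcl phi (fun t => WE.refl _) ?_
    (fun t => mf_le_aniso (hle t) hfull) (by decide)
  intro t
  simp [phi, dd1]; ring

theorem wd_case2 (h2 : (2:K) ≠ 0) (u π : Kˣ)
    (hc : ∀ x : Kˣ, ∃ y : Kˣ, x = y^2 ∨ x = u*y^2 ∨ x = π*y^2 ∨ x = u*π*y^2)
    (han : ∀ x y z w : K, x^2 - u*y^2 + π*(z^2 - u*w^2) = 0 → x = 0 ∧ y = 0 ∧ z = 0 ∧ w = 0)
    (hm : ∃ y : Kˣ, -1 = u*y^2) (hrs : ∃ r s : K, r^2+s^2 = -1) : Nonempty (WD K T2 dd2) := by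
  obtain ⟨i, hi⟩ := hm
  obtain ⟨r, s, hrs⟩ := hrs
  have hgg : ∀ a : Kˣ, QIsom (mf ({-a, -a} : Multiset Kˣ)) (mf {a, a}) := by
    intro a
    refine (mf_two _ _).trans (QIsom.trans ?_ (mf_two _ _).symm)
    refine ⟨LinearEquiv.ofLinear
      ((r • LinearMap.fst K K K - s • LinearMap.snd K K K).prod (s • LinearMap.fst K K K + r • LinearMap.snd K K K))
      (-((r • LinearMap.fst K K K + s • LinearMap.snd K K K).prod (-s • LinearMap.fst K K K + r • LinearMap.snd K K K))) ?_ ?_, ?_⟩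
    · ext <;> simp <;> first | linear_combination -hrs | linear_combination hrs | ring
    · ext <;> simp <;> first | linear_combination -hrs | linear_combination hrs | ring
    · intro x
      simp [one1_apply]
      linear_combination (a:K) * (x.1*x.1+x.2*x.2) * hrs
  have h4 : ∀ a : Kˣ, WE (4 • ({a} : Multiset Kˣ)) 0 := by
    intro a
    have h1 := (WE.refl ({a, a} : Multiset Kˣ)).add (WE.of_isom (hgg a).symm)
    have h3 := (WE.hyp h2 a).add (WE.hyp h2 a)
    have e1 : (4 • ({a} : Multiset Kˣ)) = {a, a} + {a, a} := by
      simp only [Multiset.insert_eq_cons, ← Multiset.singleton_add]; abel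
    have e2 : ({a, a} + {-a, -a} : Multiset Kˣ) = {a, -a} + {a, -a} := by
      simp only [Multiset.insert_eq_cons, ← Multiset.singleton_add]; abel
    rw [add_zero, ← e2] at h3
    rw [e1]
    exact h1.trans h3
  have h3 : ∀ a : Kˣ, WE {-a} (3 • ({a} : Multiset Kˣ)) := by
    intro a
    have h1 := (h4 a).symm.add (WE.refl {-a})
    rw [zero_add] at h1
    refine h1.trans ?_
    have h5 := (WE.refl (3 • ({a} : Multiset Kˣ))).add (WE.hyp h2 a)
    have e1 : (4 • ({a} : Multiset Kˣ)) + {-a} = 3 • {a} + {a, -a} := by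
      simp only [Multiset.insert_eq_cons, ← Multiset.singleton_add]; abel
    rw [e1]; rwa [add_zero] at h5
  let phi : T2 → Multiset Kˣ := fun t => t.1.val • {1} + t.2.val • {π}
  have hcl : ∀ x : Kˣ, ∃ t : T2, WE {x} (phi t) := by
    have v1 : (1 : ZMod 4).val = 1 := rfl
    have v3 : (3 : ZMod 4).val = 3 := rfl
    have v0 : (0 : ZMod 4).val = 0 := rfl
    have hu : ∀ g y : Kˣ, u * g * y^2 = -g * (i⁻¹ * y)^2 := by
      intro g y
      have : -g = u * g * i^2 := by rw [mul_right_comm, ← hi]; simp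
      rw [this, mul_pow, inv_pow, mul_assoc (u*g), mul_inv_cancel_left]
    intro x
    obtain ⟨y, hy | hy | hy | hy⟩ := hc x
    · refine ⟨(1,0), ?_⟩
      have := we_sq 1 y
      rw [one_mul, ← hy] at this
      simpa only [phi, v0, v1, zero_smul, one_smul, add_zero, zero_add] using this
    · refine ⟨(3,0), ?_⟩
      have := we_sq (-1) (i⁻¹ * y)
      rw [← hu, mul_one, ← hy] at this
      have := this.trans (h3 _)
      simpa only [phi, v0, v3, zero_smul, one_smul, add_zero, zero_add] using this
    · refine ⟨(0,1), ?_⟩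
      have := we_sq π y
      rw [← hy] at this
      simpa only [phi, v0, v1, zero_smul, one_smul, add_zero, zero_add] using this
    · refine ⟨(0,3), ?_⟩
      have := we_sq (-π) (i⁻¹ * y)
      rw [← hu, ← hy] at this
      have := this.trans (h3 _)
      simpa only [phi, v0, v3, zero_smul, one_smul, add_zero, zero_add] using this
  have hphi0 : phi 0 = 0 := by simp [phi]
  have hadd : ∀ a b, WE (phi a + phi b) (phi (a + b)) := by
    intro a b
    have e : phi a + phi b = (a.1.val • {1} + b.1.val • {1}) + (a.2.val • {π} + b.2.val • {π}) := by
      simp only [phi]; abel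
    rw [e]
    exact (we_val_add 4 _ (h4 _) _ _).add (we_val_add 4 _ (h4 _) _ _)
  have hfull : (mf ({1, 1, π, π} : Multiset Kˣ)).Anisotropic := by
    apply mf_four_aniso
    intro x y z w h
    have hi' : u * (i:K)^2 = -1 := by rw [← Units.val_pow_eq_pow_val, ← Units.val_mul, ← hi]; simp
    have hne := i.ne_zero
    obtain ⟨h1, h2, h3, h4⟩ := han x (i*y) z (i*w) (by
      simp only [Units.val_one] at h
      linear_combination h - (y^2 + π * w^2) * hi')
    simp [hne] at h2 h4
    exact ⟨h1, h2, h3, h4⟩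
  let rr : Kˣ → ZMod 4 → Multiset Kˣ := fun g z => if z.val = 3 then {-g} else z.val • {g}
  have hrr : ∀ g z, WE (rr g z) (z.val • {g}) := by
    intro g z
    simp only [rr]
    split_ifs with h
    · rw [h]; exact h3 g
    · exact WE.refl _
  have hcard : ∀ g z, (rr g z).card = d4 z := by
    intro g z
    simp only [rr, d4]
    have : z.val < 4 := z.val_lt
    split_ifs with h
    · simp [h]
    · rw [Multiset.card_nsmul, Multiset.card_singleton]; omega
  have hle : ∀ g z, ∃ s : Multiset Kˣ, rr g z ≤ s ∧ QIsom (mf s) (mf {g, g}) := by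
    intro g z
    simp only [rr]
    have : z.val < 4 := z.val_lt
    split_ifs with h
    · exact ⟨{-g, -g}, by simp, hgg g⟩
    · refine ⟨{g, g}, ?_, QIsom.refl _⟩
      have e : ({g, g} : Multiset Kˣ) = 2 • {g} := by rw [two_smul]; rfl
      rw [e]
      have e2 : (2 • {g} : Multiset Kˣ) = z.val • {g} + (2 - z.val) • {g} := by
        rw [← add_smul]; congr 1; omega
      rw [e2]; exact Multiset.le_add_right _ _
  refine wd_of_phi h2 phi hphi0 hadd hcl (fun t => rr 1 t.1 + rr π t.2)
    (fun t => (hrr _ _).add (hrr _ _)) ?_ ?_ (by decide)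
  · intro t; rw [Multiset.card_add, hcard, hcard]; rfl
  · intro t
    obtain ⟨s1, hs1, hs1'⟩ := hle 1 t.1
    obtain ⟨s2, hs2, hs2'⟩ := hle π t.2
    refine mf_le_aniso (add_le_add hs1 hs2) ((mf_add_congr hs1' hs2').symm.aniso hfull)

theorem exists_wd (p : ℕ) [Fact p.Prime] (hp : p ≠ 2) (K : Type) [Field K]
    [Algebra ℚ_[p] K] [FiniteDimensional ℚ_[p] K] :
    Nonempty (WD K T1 dd1) ∨ Nonempty (WD K T2 dd2) := by
  obtain ⟨h2, u, π, hc, han, h | ⟨h, h'⟩⟩ := padic_facts p hp K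
  · exact Or.inl (wd_case1 h2 u π hc han h)
  · exact Or.inr (wd_case2 h2 u π hc han h h')
end WDConstruct

section Counting

def SS {T : Type} [Fintype T] (dd : T → ℕ) (m : ℕ) : Finset T :=
  Finset.univ.filter (fun t => dd t ≤ m ∧ dd t % 2 = m % 2)

structure CD (T : Type) [AddCommGroup T] [Fintype T] [DecidableEq T] (dd : T → ℕ) (η : T) : Prop where
  par : ∀ x s : T, dd (x - s) % 2 = (dd x + dd s) % 2
  f1 : ∀ w : T, ∑ s ∈ SS dd 1, (2 - (dd (w - s) : ℤ)) = 2 * (2 - dd w)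
  f2 : ∀ w : T, ∑ s ∈ SS dd 2, (2 - (dd (w - s) : ℤ)) = 2 - dd w
  f3 : ∀ w : T, ∑ s ∈ SS dd 3, (2 - (dd (w - s) : ℤ)) = 0
  f4 : ∀ w : T, ∑ s ∈ SS dd 4, (2 - (dd (w - s) : ℤ)) = 0
  c1 : (SS dd 1).card = 4
  c2 : (SS dd 2).card = 7
  c3 : (SS dd 3).card = 8
  c4 : (SS dd 4).card = 8
  neg : ∀ t : T, dd (-t) = dd t
  eta2 : η + η = 0
  dd4 : ∀ t : T, dd t = 4 ↔ t = η
  dd0 : ∀ t : T, dd t = 0 ↔ t = 0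
  ddeta : ∀ t : T, dd (t - η) + dd t = 4

set_option maxRecDepth 100000 in
set_option maxHeartbeats 4000000 in
theorem cd1 : CD T1 dd1 (1,1,1,1) := by
  constructor <;> decide

set_option maxRecDepth 100000 in
set_option maxHeartbeats 4000000 in
theorem cd2 : CD T2 dd2 (2,2) := by
  constructor <;> decide
variable {T : Type} [AddCommGroup T] [Fintype T] [DecidableEq T] {dd : T → ℕ} {η : T}

/-- inner (parity-satisfied) part of the counting formula -/
def GI (dd : T → ℕ) (η : T) (a b c : ℕ) (w : T) : ℤ :=
  4^a*7^b*8^c + (if c = 0 then (if a = 0 then (-1)^b * (8 * (if w = b • η then 1 else 0) - 1)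
    else (2 - (dd w : ℤ)) * 2^(a+1)) else 0)

def Good (dd : T → ℕ) (η : T) (a b c q : ℕ) (g : T → ℤ) : Prop :=
  (a = 0 → c = 0 → q % 2 = 0) ∧ ∀ w, 8 * g w = if dd w % 2 = q % 2 then GI dd η a b c w else 0

theorem good_step (h : CD T dd η) {a b c q : ℕ} {g : T → ℤ} (hg : Good dd η a b c q g) (m : ℕ) (w : T) :
    8 * ∑ s ∈ SS dd m, g (w - s) = if dd w % 2 = (q + m) % 2 then ∑ s ∈ SS dd m, GI dd η a b c (w - s) else 0 := by
  rw [Finset.mul_sum]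
  split_ifs with hw
  · refine Finset.sum_congr rfl (fun s hs => ?_)
    simp only [SS, Finset.mem_filter, Finset.mem_univ, true_and] at hs
    have := h.par w s
    rw [hg.2, if_pos (by omega)]
  · refine Finset.sum_eq_zero (fun s hs => ?_)
    simp only [SS, Finset.mem_filter, Finset.mem_univ, true_and] at hs
    have := h.par w s
    rw [hg.2, if_neg (by omega)]

theorem sum_ind (S : Finset T) (w x : T) :
    ∑ s ∈ S, (if w - s = x then (1:ℤ) else 0) = if w - x ∈ S then 1 else 0 := by
  have : ∀ s, (w - s = x) ↔ (s = w - x) := fun s => by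
    constructor
    · rintro rfl; abel
    · rintro rfl; abel
  simp only [this]
  simp

theorem CD.beta (h : CD T dd η) (b : ℕ) : b • η = if b % 2 = 0 then 0 else η := by
  have h2 : 2 • η = 0 := by rw [two_smul]; exact h.eta2
  conv_lhs => rw [← Nat.mod_add_div b 2, add_smul, mul_comm, mul_smul, h2, smul_zero, add_zero]
  rcases Nat.mod_two_eq_zero_or_one b with hb | hb <;> simp [hb]

theorem CD.le4 (h : CD T dd η) (t : T) : dd t ≤ 4 := by have := h.ddeta t; omega

theorem sum_GI (S : Finset T) (a b c : ℕ) (w : T) :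
    ∑ s ∈ S, GI dd η a b c (w - s) = (S.card : ℤ) * (4^a*7^b*8^c) +
      (if c = 0 then (if a = 0 then (-1)^b * (8 * (if w - b • η ∈ S then 1 else 0) - (S.card : ℤ))
        else (∑ s ∈ S, (2 - (dd (w - s) : ℤ))) * 2^(a+1)) else 0) := by
  unfold GI
  rw [Finset.sum_add_distrib, Finset.sum_const, nsmul_eq_mul]
  congr 1
  by_cases h1 : c = 0
  · by_cases h2 : a = 0
    · simp only [h1, h2, if_true]
      rw [← Finset.mul_sum, Finset.sum_sub_distrib, ← Finset.mul_sum, sum_ind]; simp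
    · simp only [h1, h2, if_true, if_false]
      rw [← Finset.sum_mul]
  · simp [h1]

theorem neg_one_pow_mod (b : ℕ) : (-1:ℤ)^b = if b % 2 = 0 then 1 else -1 := by
  rcases Nat.mod_two_eq_zero_or_one b with hb | hb
  · rw [if_pos hb]; exact Even.neg_one_pow (Nat.even_iff.mpr hb)
  · rw [if_neg (by omega)]; exact Odd.neg_one_pow (Nat.odd_iff.mpr hb)

theorem good1 (h : CD T dd η) {a b c q : ℕ} {g : T → ℤ} (hg : Good dd η a b c q g) :
    Good dd η (a+1) b c (q+1) (fun w => ∑ s ∈ SS dd 1, g (w - s)) := by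
  refine ⟨by omega, fun w => ?_⟩
  rw [good_step h hg]
  split_ifs with hw
  · rw [sum_GI, h.f1, h.c1]
    unfold GI
    by_cases hc : c = 0
    · by_cases ha : a = 0
      · have hq := hg.1 ha hc
        simp only [hc, ha, if_true, h.beta, neg_one_pow_mod]
        have h5 := h.ddeta w
        rcases Nat.mod_two_eq_zero_or_one b with hb | hb
        · simp [hb, SS]
          split_ifs with h3
          · have : dd w = 1 := by omega
            rw [this]; norm_num
          · have : dd w = 3 := by omega
            rw [this]; norm_num
        · simp [hb, SS]
          split_ifs with h3
          · have : dd w = 3 := by omega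
            rw [this]; norm_num
          · have : dd w = 1 := by omega
            rw [this]; norm_num
      · simp [hc, ha]; ring
    · simp [hc]; ring
  · rfl

theorem good2 (h : CD T dd η) {a b c q : ℕ} {g : T → ℤ} (hg : Good dd η a b c q g) :
    Good dd η a (b+1) c (q+2) (fun w => ∑ s ∈ SS dd 2, g (w - s)) := by
  refine ⟨fun h1 h2 => by have := hg.1 h1 h2; omega, fun w => ?_⟩
  rw [good_step h hg]
  split_ifs with hw
  · rw [sum_GI, h.f2, h.c2]
    unfold GI
    by_cases hc : c = 0
    · by_cases ha : a = 0
      · have hq := hg.1 ha hc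
        have key : (w - b • η ∈ SS dd 2) ↔ ¬ (w = (b+1) • η) := by
          have h6 : w = (b+1) • η ↔ w - b • η = η := by
            rw [add_smul, one_smul, sub_eq_iff_eq_add, add_comm]
          rw [h6, ← h.dd4]
          have h5 := h.le4 (w - b • η)
          have h7 := h.par w (b • η)
          have h8 : dd (b • η) % 2 = 0 := by
            rw [h.beta]; split_ifs
            · rw [(h.dd0 0).mpr rfl]
            · rw [(h.dd4 η).mpr rfl]
          simp only [SS, Finset.mem_filter, Finset.mem_univ, true_and]
          omega
        simp only [hc, ha, if_true, key, pow_succ]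
        split_ifs <;> first | (push_cast; ring1) | tauto
      · simp [hc, ha]; ring
    · simp [hc]; ring
  · rfl

theorem good3 (h : CD T dd η) {a b c q : ℕ} {g : T → ℤ} (hg : Good dd η a b c q g) (m : ℕ) (hm : 3 ≤ m) :
    Good dd η a b (c+1) (q+m) (fun w => ∑ s ∈ SS dd m, g (w - s)) := by
  refine ⟨by omega, fun w => ?_⟩
  rw [good_step h hg]
  split_ifs with hw
  · have hS : (SS dd m).card = 8 ∧ ∑ s ∈ SS dd m, (2 - (dd (w - s) : ℤ)) = 0 := by
      have : SS dd m = SS dd 3 ∨ SS dd m = SS dd 4 := by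
        rcases Nat.mod_two_eq_zero_or_one m with h1 | h1
        · right
          ext t
          simp only [SS, Finset.mem_filter, Finset.mem_univ, true_and]
          have := h.le4 t
          omega
        · left
          ext t
          simp only [SS, Finset.mem_filter, Finset.mem_univ, true_and]
          have := h.le4 t
          omega
      rcases this with h1 | h1 <;> rw [h1]
      · exact ⟨h.c3, h.f3 w⟩
      · exact ⟨h.c4, h.f4 w⟩
    rw [sum_GI, hS.1, hS.2]
    unfold GI
    by_cases hc : c = 0
    · by_cases ha : a = 0
      · have hq := hg.1 ha hc
        have key : (w - b • η ∈ SS dd m) := by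
          have h5 := h.le4 (w - b • η)
          have h7 := h.par w (b • η)
          have h8 : dd (b • η) % 2 = 0 := by
            rw [h.beta]; split_ifs
            · rw [(h.dd0 0).mpr rfl]
            · rw [(h.dd4 η).mpr rfl]
          simp only [SS, Finset.mem_filter, Finset.mem_univ, true_and]
          omega
        simp [hc, ha, key]; ring
      · simp [hc, ha]; ring
    · simp [hc]; ring
  · rfl

theorem good0 (h : CD T dd η) {a b c q : ℕ} {g : T → ℤ} (hg : Good dd η a b c q g) :
    Good dd η a b c (q+0) (fun w => ∑ s ∈ SS dd 0, g (w - s)) := by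
  have : SS dd 0 = {0} := by
    ext t
    simp only [SS, Finset.mem_filter, Finset.mem_univ, true_and, Finset.mem_singleton, ← h.dd0]
    omega
  simpa [this] using hg

noncomputable def EE (dd : T → ℕ) (m : ℕ) : AddMonoidAlgebra ℤ T := ∑ s ∈ SS dd m, AddMonoidAlgebra.single s 1

theorem EE_mul (m : ℕ) (F : AddMonoidAlgebra ℤ T) (w : T) :
    (EE dd m * F).coeff w = ∑ s ∈ SS dd m, F.coeff (w - s) := by
  unfold EE
  rw [Finset.sum_mul, AddMonoidAlgebra.coeff_sum, Finsupp.finset_sum_apply]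
  refine Finset.sum_congr rfl (fun s _ => ?_)
  have := AddMonoidAlgebra.coeff_single_mul_add F 1 s (w - s)
  rw [add_sub_cancel, one_mul] at this
  exact this

theorem good_prod (h : CD T dd η) {ι : Type} [DecidableEq ι] (m : ι → ℕ) (J : Finset ι) :
    Good dd η (J.filter (fun j => m j = 1)).card (J.filter (fun j => m j = 2)).card
      (J.filter (fun j => 3 ≤ m j)).card (∑ j ∈ J, m j)
      (fun w => (∏ j ∈ J, EE dd (m j)).coeff w) := by
  induction J using Finset.induction_on with
  | empty =>
    refine ⟨by simp, fun w => ?_⟩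
    simp only [Finset.prod_empty, AddMonoidAlgebra.one_def, GI]
    by_cases hw : w = 0
    · subst hw; simp [(h.dd0 0).mpr rfl]
    · simp [hw, AddMonoidAlgebra.coeff_single, Finsupp.single_apply, Ne.symm hw]
  | insert i J hi ih =>
    simp only [Finset.prod_insert hi, Finset.sum_insert hi, Finset.filter_insert, EE_mul]
    rw [add_comm (m i)]
    have hcases : m i = 0 ∨ m i = 1 ∨ m i = 2 ∨ 3 ≤ m i := by omega
    rcases hcases with h1 | h1 | h1 | h1
    · have := good0 h ih
      simpa [h1] using this
    · have := good1 h ih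
      simpa [h1, hi] using this
    · have := good2 h ih
      simpa [h1, hi] using this
    · have := good3 h ih (m i) h1
      have e1 : m i ≠ 1 := by omega
      have e2 : m i ≠ 2 := by omega
      simpa [h1, hi, e1, e2] using this

theorem prod_coeff {ι : Type} [Fintype ι] [DecidableEq ι] (m : ι → ℕ) (w : T) :
    (∏ j, EE dd (m j)).coeff w =
      Nat.card {x : ι → T // (∀ j, dd (x j) ≤ m j ∧ dd (x j) % 2 = m j % 2) ∧ ∑ j, x j = w} := by
  unfold EE
  rw [Finset.prod_univ_sum]
  simp only [AddMonoidAlgebra.prod_single, Finset.prod_const_one]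
  rw [AddMonoidAlgebra.coeff_sum, Finsupp.finset_sum_apply]
  simp only [AddMonoidAlgebra.coeff_single, Finsupp.single_apply]
  rw [Finset.sum_ite, Finset.sum_const_zero, add_zero, Finset.sum_const, Nat.card_eq_fintype_card,
    Fintype.card_subtype]
  simp only [nsmul_eq_mul, mul_one]
  congr 2
  ext x
  simp [SS, Fintype.mem_piFinset]

theorem count_main (h : CD T dd η) {ι : Type} [Fintype ι] [DecidableEq ι] (m : ι → ℕ) (w : T) (N : ℕ)
    (hN : N = Nat.card {x : ι → T // (∀ j, dd (x j) ≤ m j ∧ dd (x j) % 2 = m j % 2) ∧ ∑ j, x j = w})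
    (hw : dd w % 2 = (∑ j, m j) % 2) (a b c : ℕ)
    (ha : a = (Finset.univ.filter (fun j => m j = 1)).card)
    (hb : b = (Finset.univ.filter (fun j => m j = 2)).card)
    (hc : c = (Finset.univ.filter (fun j => 3 ≤ m j)).card) :
    (1 ≤ c → (8 : ℤ) * N = 4 ^ a * 7 ^ b * 8 ^ c) ∧
    (c = 0 → 0 < a → (8 : ℤ) * N = 4 ^ a * 7 ^ b + (2 - (dd w : ℤ)) * 2 ^ (a + 1)) ∧
    (a = 0 → c = 0 → (N : ℤ) = (7 ^ b - (-1 : ℤ) ^ b) / 8 +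
      (if dd w = 0 ∧ Even b then (1 : ℤ) else if dd w = 4 ∧ Odd b then -1 else 0)) := by
  obtain ⟨-, hg⟩ := good_prod h m Finset.univ
  have hg := hg w
  rw [if_pos hw, ← ha, ← hb, ← hc] at hg
  simp only [prod_coeff, ← hN] at hg
  unfold GI at hg
  refine ⟨fun h1 => ?_, fun h1 h2 => ?_, fun h1 h2 => ?_⟩
  · rw [hg, if_neg (by omega), add_zero]
  · rw [hg, if_pos h1, if_neg (by omega), h1]; ring
  · rw [if_pos h2, if_pos h1, h1, h2] at hg
    rw [h.beta, neg_one_pow_mod] at hg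
    rw [neg_one_pow_mod]
    rcases Nat.mod_two_eq_zero_or_one b with hb' | hb'
    · have e1 : Even b := Nat.even_iff.mpr hb'
      simp only [hb', if_true, ← h.dd0] at hg
      have e2 : ¬ Odd b := Nat.not_odd_iff_even.mpr e1
      simp only [hb', e1, e2, and_true, and_false, if_true, if_false]
      split_ifs at hg ⊢ <;> omega
    · have e1 : Odd b := Nat.odd_iff.mpr hb'
      have e2 : ¬ Even b := Nat.not_even_iff_odd.mpr e1
      simp only [hb', one_ne_zero, if_false, ← h.dd4] at hg
      simp only [hb', e1, e2, and_true, and_false, if_true, if_false, one_ne_zero]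
      split_ifs at hg ⊢ <;> omega
end Counting

section Model
variable {K : Type} [Field K] {n : ℕ} {m : Fin n → ℕ}

/-- the model space -/
abbrev MM (K : Type) [Field K] (n : ℕ) (m : Fin n → ℕ) : Type :=
  ∀ j : Fin n, Fin ((j : ℕ) + 1) → Fin (m j) → K

/-- the shift -/
def XX (K : Type) [Field K] (n : ℕ) (m : Fin n → ℕ) : Module.End K (MM K n m) where
  toFun f j i := if h : 1 ≤ (i : ℕ) then f j ⟨i - 1, by omega⟩ else 0
  map_add' f g := by
    ext j i k; simp only [Pi.add_apply]; split_ifs <;> simp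
  map_smul' c f := by
    ext j i k; simp only [Pi.smul_apply, RingHom.id_apply]; split_ifs <;> simp

theorem XX_pow (k : ℕ) (f : MM K n m) (j : Fin n) (i : Fin ((j:ℕ) + 1)) :
    ((XX K n m) ^ k) f j i = if h : k ≤ (i : ℕ) then f j ⟨i - k, by omega⟩ else 0 := by
  induction k generalizing f with
  | zero => simp
  | succ k ih =>
    rw [pow_succ, Module.End.mul_apply, ih]
    by_cases h : k + 1 ≤ (i:ℕ)
    · have h1 : k ≤ (i:ℕ) := by omega
      rw [dif_pos h1, dif_pos h]
      simp only [XX, LinearMap.coe_mk, AddHom.coe_mk]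
      rw [dif_pos (by omega)]
      congr 2
    · rw [dif_neg h]
      split_ifs with h1
      · simp only [XX, LinearMap.coe_mk, AddHom.coe_mk]
        rw [dif_neg (by omega)]
      · rfl

theorem XX_ker (k : ℕ) (f : MM K n m) :
    ((XX K n m) ^ k) f = 0 ↔ ∀ (j : Fin n) (i : Fin ((j:ℕ)+1)), (i:ℕ) + k < j + 1 → f j i = 0 := by
  constructor
  · intro h j i hi
    have := congrFun (congrFun h j) ⟨i + k, hi⟩
    rw [XX_pow, dif_pos (by simp)] at this
    simpa using this
  · intro h
    ext1 j; ext1 i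
    rw [XX_pow]
    split_ifs with hk
    · exact h _ _ (by simp; omega)
    · rfl

theorem XX_nilp : (XX K n m) ^ (n+1) = 0 := by
  refine LinearMap.ext (fun f => ?_)
  rw [LinearMap.zero_apply, XX_ker]
  intro j i hi
  omega

/-- basic elements -/
def ee (j : Fin n) (i : Fin ((j:ℕ)+1)) : (Fin (m j) → K) →ₗ[K] MM K n m :=
  (LinearMap.single K (fun j : Fin n => Fin ((j:ℕ)+1) → Fin (m j) → K) j).comp
    (LinearMap.single K (fun _ : Fin ((j:ℕ)+1) => Fin (m j) → K) i)

theorem ee_apply_same (j : Fin n) (i i' : Fin ((j:ℕ)+1)) (w : Fin (m j) → K) :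
    ee j i w j i' = if i' = i then w else 0 := by
  simp [ee, Pi.single_apply]
theorem ee_apply_ne (j l : Fin n) (h : l ≠ j) (i : Fin ((j:ℕ)+1)) (w : Fin (m j) → K) :
    ee j i w l = 0 := by
  simp [ee, Pi.single_eq_of_ne h]

abbrev sg (j : Fin n) : (Fin (m j) → K) →ₗ[K] MM K n m := ee j 0
abbrev pr (f : MM K n m) (j : Fin n) : (Fin (m j) → K) := f j 0

theorem sg_a (j : Fin n) (w : Fin (m j) → K) : ((XX K n m)^((j:ℕ)+1)) (sg j w) = 0 := by
  rw [XX_ker]; intro l i hi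
  by_cases h : l = j
  · subst h; omega
  · rw [ee_apply_ne _ _ h]; rfl

theorem sg_b (j : Fin n) (w : Fin (m j) → K) : pr (sg j w) j = w := by
  simp [pr, ee_apply_same]

theorem XX_top (j : Fin n) (w : Fin (m j) → K) : ((XX K n m)^(j:ℕ)) (sg j w) = ee j (Fin.last _) w := by
  ext1 l; ext1 i
  rw [XX_pow]
  by_cases h : l = j
  · subst h
    rw [ee_apply_same]
    split_ifs with h1 h2 h2
    · rw [ee_apply_same, if_pos]; ext; simp [h2]
    · exfalso; apply h2; ext; simp; omega
    · exfalso; apply h1; rw [h2]; simp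
    · rfl
  · rw [ee_apply_ne _ _ h, ee_apply_ne _ _ h]; split_ifs <;> rfl

theorem sg_c (j : Fin n) (y : MM K n m) (hy : ((XX K n m)^((j:ℕ)+1)) y = 0) :
    ∃ z, ((XX K n m)^(j:ℕ)) y = ((XX K n m)^(j:ℕ)) (sg j (pr y j)) + ((XX K n m)^((j:ℕ)+1)) z := by
  rw [XX_ker] at hy
  refine ⟨fun l i => if h : (i:ℕ) + j + 1 = l then y l ⟨i+1, by omega⟩ else 0, ?_⟩
  rw [XX_top]
  ext1 l; ext1 i
  simp only [Pi.add_apply]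
  rw [XX_pow, XX_pow]
  by_cases h : l = j
  · subst h
    rw [ee_apply_same]
    by_cases h1 : (l:ℕ) ≤ i
    · have : i = Fin.last _ := by ext; simp; omega
      subst this
      simp [pr]
    · rw [dif_neg h1, if_neg (by rintro rfl; simp at h1), dif_neg (by omega)]; simp
  · rw [ee_apply_ne _ _ h]
    have hne : (l:ℕ) ≠ j := fun h' => h (Fin.ext h')
    by_cases h1 : (j:ℕ) ≤ i
    · rw [dif_pos h1]
      by_cases h2 : (j:ℕ)+1 ≤ i
      · rw [dif_pos h2]
        by_cases h3 : (i:ℕ) = l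
        · simp only
          rw [dif_pos (by omega)]
          simp only [Pi.zero_apply, zero_add]
          congr 2; omega
        · rw [dif_neg (by simp only; omega), hy l _ (by simp only; omega)]; simp
      · rw [dif_neg h2, hy l _ (by simp only; omega)]; simp
    · rw [dif_neg h1, dif_neg (by omega)]; simp

theorem sg_d (j : Fin n) (w : Fin (m j) → K) (z : MM K n m)
    (h : ((XX K n m)^(j:ℕ)) (sg j w) = ((XX K n m)^((j:ℕ)+1)) z) : w = 0 := by
  rw [XX_top] at h
  have := congrFun (congrFun h j) (Fin.last _)
  rw [ee_apply_same, XX_pow, if_pos rfl, dif_neg (by simp)] at this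
  exact this

/-- extending automorphisms -/
def PhiE (g : ∀ j, (Fin (m j) → K) ≃ₗ[K] (Fin (m j) → K)) : MM K n m ≃ₗ[K] MM K n m :=
  LinearEquiv.piCongrRight (fun j => LinearEquiv.piCongrRight (fun _ => g j))

theorem PhiE_apply (g : ∀ j, (Fin (m j) → K) ≃ₗ[K] (Fin (m j) → K)) (f : MM K n m) (j) (i) :
  PhiE g f j i = g j (f j i) := rfl

theorem PhiE_comm (g : ∀ j, (Fin (m j) → K) ≃ₗ[K] (Fin (m j) → K)) (f : MM K n m) :
    PhiE g (XX K n m f) = XX K n m (PhiE g f) := by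
  ext1 j; ext1 i
  rw [PhiE_apply]
  simp only [XX, LinearMap.coe_mk, AddHom.coe_mk]
  split_ifs
  · rfl
  · simp

theorem PhiE_sg (g : ∀ j, (Fin (m j) → K) ≃ₗ[K] (Fin (m j) → K)) (j : Fin n) (w : Fin (m j) → K) :
    PhiE g (sg j w) = sg j (g j w) := by
  ext1 l; ext1 i
  rw [PhiE_apply]
  by_cases h : l = j
  · subst h; rw [ee_apply_same, ee_apply_same]; split_ifs <;> simp
  · rw [ee_apply_ne _ _ h, ee_apply_ne _ _ h]; simp

theorem sum_ee (f : MM K n m) : f = ∑ j, ∑ i, ee j i (f j i) := by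
  ext1 l; ext1 i
  rw [Finset.sum_apply, Finset.sum_eq_single l, Finset.sum_apply]
  · simp [ee_apply_same]
  · intro j _ hj
    rw [Finset.sum_apply]
    exact Finset.sum_eq_zero (fun i _ => ee_apply_ne _ _ (Ne.symm hj) _ _)
  · simp
end Model

section Skew
variable {K : Type} [Field K] {V : Type} [AddCommGroup V] [Module K V]

/-- symmetric nondegenerate form for which `X` is skew -/
structure SK (X : Module.End K V) (B : V →ₗ[K] V →ₗ[K] K) : Prop where
  symm : ∀ x y, B x y = B y x
  nd : ∀ x, (∀ y, B x y = 0) → x = 0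
  skew : ∀ x y, B (X x) y = - B x (X y)

theorem SK.pow {X : Module.End K V} {B : V →ₗ[K] V →ₗ[K] K} (h : SK X B) (k : ℕ) (x y : V) :
    B ((X^k) x) y = (-1)^k * B x ((X^k) y) := by
  induction k generalizing x y with
  | zero => simp
  | succ k ih =>
    rw [pow_succ X, Module.End.mul_apply, ih, h.skew, ← pow_succ, pow_succ' X, Module.End.mul_apply]
    ring

theorem SK.perp [FiniteDimensional K V] {X : Module.End K V} {B : V →ₗ[K] V →ₗ[K] K} (h : SK X B) (k : ℕ) (x : V)
    (hx : ∀ y, (X^k) y = 0 → B x y = 0) : ∃ z, x = (X^k) z := by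
  have hr : LinearMap.IsRefl B := fun x y hxy => by rw [h.symm]; exact hxy
  have hnd : LinearMap.BilinForm.Nondegenerate B := by
    refine ⟨h.nd, fun y hy => h.nd y (fun x => by rw [h.symm]; exact hy x)⟩
  have h1 := LinearMap.BilinForm.orthogonal_orthogonal hnd hr (LinearMap.range (X^k))
  have h2 : x ∈ LinearMap.BilinForm.orthogonal B (LinearMap.BilinForm.orthogonal B (LinearMap.range (X^k))) := by
    rw [LinearMap.BilinForm.mem_orthogonal_iff]
    intro y hy
    rw [LinearMap.BilinForm.mem_orthogonal_iff] at hy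
    change B y x = 0
    rw [h.symm]
    apply hx
    apply h.nd
    intro w
    have := hy ((X^k) w) ⟨w, rfl⟩
    change B ((X^k) w) y = 0 at this
    rw [h.pow] at this
    rw [h.symm]
    rcases mul_eq_zero.mp this with h5 | h5
    · exact absurd h5 (pow_ne_zero _ (by simp))
    · exact h5
  rw [h1] at h2
  obtain ⟨z, hz⟩ := h2
  exact ⟨z, hz.symm⟩
end Skew

section Sqrt
variable {K : Type} [Field K] {V : Type} [AddCommGroup V] [Module K V]

theorem exists_sqrt (h2 : (2:K) ≠ 0) (T : Module.End K V) (hT : IsNilpotent T) :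
    ∃ C ∈ Algebra.adjoin K {T}, C * C = 1 + T := by
  let S := Algebra.adjoin K {T}
  letI : CommRing S := Algebra.adjoinCommRingOfComm K (by
    intro a ha b hb
    rw [Set.mem_singleton_iff] at ha hb
    rw [ha, hb])
  let t : S := ⟨T, Algebra.subset_adjoin rfl⟩
  have ht : IsNilpotent t := by
    obtain ⟨k, hk⟩ := hT
    exact ⟨k, Subtype.ext (by simpa [t] using hk)⟩
  let P : Polynomial S := Polynomial.X^2 - Polynomial.C (1 + t)
  obtain ⟨r, ⟨-, hr⟩, -⟩ := Polynomial.existsUnique_nilpotent_sub_and_aeval_eq_zero (R := S) (S := S) (P := P) (x := (1 : S))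
    (by simp [P]; exact ht)
    (by
      simp [P, Polynomial.derivative_X_pow]
      have : (1 + 1 : S) = algebraMap K S 2 := by
        apply Subtype.ext
        refine LinearMap.ext fun v => ?_
        rw [show (2:K) = 1 + 1 by norm_num, map_add, map_one]
      rw [this]
      exact (IsUnit.mk0 _ h2).map (algebraMap K S))
  refine ⟨r.1, r.2, ?_⟩
  simp [P] at hr
  have h3 : r * r = 1 + t := by linear_combination hr
  exact congrArg Subtype.val h3
end Sqrt

section Core
variable {K : Type} [Field K] {n : ℕ} {m : Fin n → ℕ}
open LinearMap

/-- the forms on the multiplicity spaces -/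
def bet (B : MM K n m →ₗ[K] MM K n m →ₗ[K] K) (j : Fin n) (v w : Fin (m j) → K) : K :=
  B (sg j v) (((XX K n m)^(j:ℕ)) (sg j w))

variable {B B' : MM K n m →ₗ[K] MM K n m →ₗ[K] K}

theorem bet_ker (h : SK (XX K n m) B) (j : Fin n) (x y : MM K n m) (hx : ((XX K n m)^((j:ℕ)+1)) x = 0)
    (hy : ((XX K n m)^((j:ℕ)+1)) y = 0) :
    B x (((XX K n m)^(j:ℕ)) y) = bet B j (pr x j) (pr y j) := by
  unfold bet
  have step : ∀ x y : MM K n m, ((XX K n m)^((j:ℕ)+1)) x = 0 → ((XX K n m)^((j:ℕ)+1)) y = 0 →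
      B x (((XX K n m)^(j:ℕ)) y) = B x (((XX K n m)^(j:ℕ)) (sg j (pr y j))) := by
    intro x y hx hy
    obtain ⟨z, hz⟩ := sg_c j y hy
    rw [hz, map_add, h.symm x (((XX K n m)^((j:ℕ)+1)) z), h.pow, hx]
    simp
  have flip : ∀ x y : MM K n m, B x (((XX K n m)^(j:ℕ)) y) = (-1)^(j:ℕ) * B y (((XX K n m)^(j:ℕ)) x) := by
    intro x y
    rw [h.symm, h.pow]
  rw [step x y hx hy, flip, step _ x (sg_a _ _) hx, flip _ (sg j (pr x j)), ← mul_assoc, ← mul_pow]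
  simp

theorem bet_symm (h : SK (XX K n m) B) (j : Fin n) (v w : Fin (m j) → K) :
    bet B j v w = (-1)^(j:ℕ) * bet B j w v := by
  unfold bet
  rw [h.symm, h.pow]

theorem bet_nd (h : SK (XX K n m) B) (j : Fin n) (v : Fin (m j) → K) (hv : ∀ w, bet B j v w = 0) : v = 0 := by
  have h1 : ∃ z, ((XX K n m)^(j:ℕ)) (sg j v) = ((XX K n m)^((j:ℕ)+1)) z := by
    apply h.perp
    intro y hy
    rw [h.symm, bet_ker h j _ _ hy (sg_a _ _), sg_b, bet_symm h, hv, mul_zero]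
  obtain ⟨z, hz⟩ := h1
  exact sg_d j v z hz

theorem core_bwd_eq (h2 : (2:K) ≠ 0) (h : SK (XX K n m) B) (h' : SK (XX K n m) B')
    (hb : ∀ j v w, bet B j v w = bet B' j v w) :
    ∃ C : MM K n m ≃ₗ[K] MM K n m, (∀ f, C (XX K n m f) = XX K n m (C f)) ∧
      ∀ x y, B (C x) (C y) = B' x y := by
  have hnd : LinearMap.BilinForm.Nondegenerate B :=
    ⟨h.nd, fun y hy => h.nd y (fun x => by rw [h.symm]; exact hy x)⟩
  let A : Module.End K (MM K n m) := (LinearMap.BilinForm.toDual B hnd).symm.toLinearMap.comp B'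
  have hA : ∀ x y, B (A x) y = B' x y := by
    intro x y
    have : LinearMap.BilinForm.toDual B hnd (A x) = B' x := by
      simp [A]
    rw [← this]; rfl
  have ext : ∀ x x', (∀ y, B x y = B x' y) → x = x' := by
    intro x x' hh
    rw [← sub_eq_zero]
    apply h.nd; intro y; rw [map_sub, LinearMap.sub_apply, hh, sub_self]
  have hAX : ∀ x, A (XX K n m x) = XX K n m (A x) := by
    intro x
    apply ext; intro y
    rw [hA, h'.skew, h.skew, hA]
  have hAs : ∀ x y, B (A x) y = B x (A y) := by
    intro x y
    rw [hA, h.symm x, hA, h'.symm]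
  let T : Module.End K (MM K n m) := A - 1
  have hTX : T * (XX K n m) = (XX K n m) * T := by
    refine LinearMap.ext (fun x => ?_)
    simp [T, hAX]
  have hTX' : ∀ k l x, (T^k) (((XX K n m)^l) x) = ((XX K n m)^l) ((T^k) x) := by
    intro k l x
    have : T^k * (XX K n m)^l = (XX K n m)^l * T^k := ((show Commute T (XX K n m) from hTX).pow_pow k l)
    exact congrArg (fun f => f x) this
  have key : ∀ (j : Fin n) (x : MM K n m), ((XX K n m)^((j:ℕ)+1)) x = 0 →
      ∃ z, ((XX K n m)^(j:ℕ)) (T x) = ((XX K n m)^((j:ℕ)+1)) z := by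
    intro j x hx
    apply h.perp
    intro y hy
    rw [h.pow]
    have : B (T x) (((XX K n m)^(j:ℕ)) y) = 0 := by
      simp only [T, LinearMap.sub_apply, Module.End.one_apply, map_sub, hA]
      rw [bet_ker h j _ _ hx hy, bet_ker h' j _ _ hx hy, hb, sub_self]
    rw [this, mul_zero]
  have hn0 : (XX K n m)^n = 0 := by
    refine LinearMap.ext (fun f => ?_)
    rw [LinearMap.zero_apply, XX_ker]
    intro j i hi; omega
  have sock : ∀ k : ℕ, k ≤ n → ∀ x, (XX K n m) x = 0 → ∃ z, (T^k) x = ((XX K n m)^k) z := by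
    intro k
    induction k with
    | zero => intro _ x _; exact ⟨x, by simp⟩
    | succ k ih =>
      intro hk x hx
      obtain ⟨z, hz⟩ := ih (by omega) x hx
      have hz' : ((XX K n m)^(k+1)) z = 0 := by
        rw [pow_succ', Module.End.mul_apply, ← hz]
        have := hTX' k 1 x
        rw [pow_one] at this
        rw [← this, hx, map_zero]
      obtain ⟨z', hz''⟩ := key ⟨k, hk⟩ z hz'
      refine ⟨z', ?_⟩
      rw [pow_succ' T, Module.End.mul_apply, hz]
      have := hTX' 1 k z
      rw [pow_one] at this
      rw [this]; exact hz''
  have hnil : ∀ i : ℕ, ∀ x, ((XX K n m)^i) x = 0 → (T^(n*i)) x = 0 := by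
    intro i
    induction i with
    | zero => intro x hx; simpa using hx
    | succ i ih =>
      intro x hx
      rw [mul_add, mul_one, pow_add, Module.End.mul_apply]
      apply ih
      rw [← hTX']
      obtain ⟨z, hz⟩ := sock n le_rfl (((XX K n m)^i) x) (by rw [← Module.End.mul_apply, ← pow_succ']; exact hx)
      rw [hz, hn0]; rfl
  have hTn : IsNilpotent T := ⟨n * n, LinearMap.ext (fun x => hnil n x (by rw [hn0]; rfl))⟩
  obtain ⟨C, hC, hCC⟩ := exists_sqrt h2 T hTn
  have hCA : C * C = A := by rw [hCC]; simp [T]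
  have hCX : ∀ f, C (XX K n m f) = XX K n m (C f) := by
    have : Commute C (XX K n m) := by
      refine Algebra.adjoin_induction (p := fun x _ => Commute x (XX K n m)) ?_ ?_ ?_ ?_ hC
      · intro x hx
        rw [Set.mem_singleton_iff] at hx; rw [hx]; exact hTX
      · intro r; exact Algebra.commutes r _
      · intro x y _ _ hx hy; exact hx.add_left hy
      · intro x y _ _ hx hy; exact hx.mul_left hy
    intro f
    exact congrArg (fun g => g f) this
  have hCs : ∀ x y, B (C x) y = B x (C y) := by
    refine Algebra.adjoin_induction (p := fun C _ => ∀ x y, B (C x) y = B x (C y)) ?_ ?_ ?_ ?_ hC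
    · intro C hC x y
      rw [Set.mem_singleton_iff] at hC; rw [hC]
      simp [T, hAs]
    · intro r x y; simp [Module.algebraMap_end_apply]
    · intro C D _ _ hC hD x y; simp [hC, hD]
    · intro C D hC' hD' hC hD x y
      have hcomm : C * D = D * C :=
        congrArg Subtype.val (mul_comm (⟨C, hC'⟩ : Algebra.adjoin K {T}) ⟨D, hD'⟩)
      rw [Module.End.mul_apply, hC, hD, ← Module.End.mul_apply, hcomm]
  have hCB : ∀ x y, B (C x) (C y) = B' x y := by
    intro x y
    rw [← hCs, ← Module.End.mul_apply, hCA, hA]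
  have hinj : Function.Injective C := by
    rw [injective_iff_map_eq_zero]
    intro x hx
    apply h'.nd
    intro y
    rw [← hCB, hx]; simp
  exact ⟨LinearEquiv.ofInjectiveEndo C hinj, fun f => hCX f, fun x y => hCB x y⟩

theorem SK.comp {V : Type} [AddCommGroup V] [Module K V] {X : Module.End K V} {B : V →ₗ[K] V →ₗ[K] K}
    {V' : Type} [AddCommGroup V'] [Module K V'] {X' : Module.End K V'}
    (h : SK X B) (e : V' ≃ₗ[K] V) (he : ∀ x, e (X' x) = X (e x)) : SK X' (B.compl₁₂ e.toLinearMap e.toLinearMap) := by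
  refine ⟨fun x y => h.symm _ _, fun x hx => ?_, fun x y => ?_⟩
  · have := h.nd (e x) (fun y => by
      have := hx (e.symm y)
      simpa using this)
    simpa using this
  · simp only [LinearMap.compl₁₂_apply, LinearEquiv.coe_coe, he]
    exact h.skew _ _

theorem core_bwd (h2 : (2:K) ≠ 0) (h : SK (XX K n m) B) (h' : SK (XX K n m) B')
    (hb : ∀ j, ∃ g : (Fin (m j) → K) ≃ₗ[K] (Fin (m j) → K), ∀ v w, bet B' j (g v) (g w) = bet B j v w) :
    ∃ C : MM K n m ≃ₗ[K] MM K n m, (∀ f, C (XX K n m f) = XX K n m (C f)) ∧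
      ∀ x y, B' (C x) (C y) = B x y := by
  choose g hg using hb
  have h'' := h'.comp (PhiE g) (PhiE_comm g)
  obtain ⟨C, hC, hCB⟩ := core_bwd_eq h2 h'' h (by
    intro j v w
    rw [← hg]
    unfold bet
    have : ∀ k f, PhiE g (((XX K n m)^k) f) = ((XX K n m)^k) (PhiE g f) := by
      intro k
      induction k with
      | zero => simp
      | succ k ih => intro f; rw [pow_succ, Module.End.mul_apply, Module.End.mul_apply, ih, PhiE_comm]
    simp only [LinearMap.compl₁₂_apply, LinearEquiv.coe_coe, this, PhiE_sg])
  refine ⟨C.trans (PhiE g), fun f => ?_, fun x y => ?_⟩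
  · simp [hC, PhiE_comm]
  · rw [← hCB]; rfl

theorem core_fwd (h : SK (XX K n m) B) (h' : SK (XX K n m) B')
    (C : MM K n m ≃ₗ[K] MM K n m) (hC : ∀ f, C (XX K n m f) = XX K n m (C f))
    (hCB : ∀ x y, B' (C x) (C y) = B x y) (j : Fin n) :
    ∃ g : (Fin (m j) → K) ≃ₗ[K] (Fin (m j) → K), ∀ v w, bet B' j (g v) (g w) = bet B j v w := by
  have hCk : ∀ k f, C (((XX K n m)^k) f) = ((XX K n m)^k) (C f) := by
    intro k
    induction k with
    | zero => simp
    | succ k ih => intro f; rw [pow_succ, Module.End.mul_apply, Module.End.mul_apply, ih, hC]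
  let g0 : (Fin (m j) → K) →ₗ[K] (Fin (m j) → K) :=
    (LinearMap.proj (0 : Fin ((j:ℕ)+1))).comp ((LinearMap.proj j).comp (C.toLinearMap.comp (sg j)))
  have hg0 : ∀ v, g0 v = pr (C (sg j v)) j := fun v => rfl
  have hg : ∀ v w, bet B' j (g0 v) (g0 w) = bet B j v w := by
    intro v w
    rw [hg0, hg0, ← bet_ker h' j, ← hCk, hCB]
    · rfl
    · rw [← hCk, sg_a, map_zero]
    · rw [← hCk, sg_a, map_zero]
  have hinj : Function.Injective g0 := by
    rw [injective_iff_map_eq_zero]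
    intro v hv
    apply bet_nd h j v
    intro w
    rw [← hg, hv]; simp [bet]
  exact ⟨LinearEquiv.ofInjectiveEndo g0 hinj, fun v w => hg v w⟩
end Core

section Lagr
variable {K : Type} [Field K] {V : Type} [AddCommGroup V] [Module K V]

theorem lagr_std (h2 : (2:K) ≠ 0) (ε : K) (hε : ε * ε = 1) [FiniteDimensional K V]
    (B : V →ₗ[K] V →ₗ[K] K) (hs : ∀ x y, B y x = ε * B x y)
    (nd : ∀ x, (∀ y, B x y = 0) → x = 0) (L : Submodule K V)
    (hL : ∀ x, x ∈ L ↔ ∀ y ∈ L, B y x = 0) :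
    ∃ k, ∃ φ : ((Fin k → K) × (Fin k → K)) ≃ₗ[K] V, ∀ a b,
      B (φ a) (φ b) = ∑ i, (a.1 i * b.2 i + ε * (a.2 i * b.1 i)) := by
  let k := Module.finrank K L
  let b : Module.Basis (Fin k) K L := Module.finBasis K L
  have hbb : ∀ i j, B (b i : V) (b j : V) = 0 := fun i j => (hL _).1 (b j).2 _ (b i).2
  have hinj : Function.Injective B := by
    rw [← LinearMap.ker_eq_bot, LinearMap.ker_eq_bot']
    intro x hx
    exact nd x (fun y => by rw [hx]; rfl)
  have hsurj : Function.Surjective B :=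
    (LinearMap.injective_iff_surjective_of_finrank_eq_finrank
      (Subspace.dual_finrank_eq (K := K) (V := V)).symm).1 hinj
  have hc : ∀ i, ∃ c : V, ∀ j, B (b j : V) c = if j = i then 1 else 0 := by
    intro i
    obtain ⟨f, hf⟩ := LinearMap.exists_extend (b.coord i)
    obtain ⟨c, hc⟩ := hsurj f
    refine ⟨ε • c, fun j => ?_⟩
    rw [map_smul, smul_eq_mul, hs c, ← mul_assoc, hε, one_mul, hc]
    have := LinearMap.congr_fun hf (b j)
    simp only [LinearMap.comp_apply, Submodule.subtype_apply] at this
    rw [this, Module.Basis.coord_apply, Module.Basis.repr_self, Finsupp.single_apply]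
  choose c hc using hc
  let t : Fin k → Fin k → K := fun i j => 2⁻¹ * B (c i) (c j)
  let c' : Fin k → V := fun i => c i - ∑ l, t i l • (b l : V)
  have hbc : ∀ i j, B (b i : V) (c' j) = if i = j then 1 else 0 := by
    intro i j
    simp only [c', map_sub, map_sum, map_smul, hbb, smul_zero, Finset.sum_const_zero, sub_zero, hc]
  have hcc : ∀ i j, B (c' i) (c' j) = 0 := by
    intro i j
    have h1 : B (c' i) (c' j) = B (c i) (c' j) - t i j := by
      simp only [c', map_sub, map_sum, map_smul, LinearMap.sub_apply, LinearMap.sum_apply, LinearMap.smul_apply, hbb, hc]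
      simp
      ring
    have h3 : B (c i) (c' j) = B (c i) (c j) - ε * t j i := by
      simp only [c', map_sub, map_sum, map_smul, hs (b _ : V) (c i), hc]
      simp [mul_comm]
    rw [h1, h3]
    simp only [t]
    rw [hs (c i) (c j)]
    field_simp
    linear_combination (-B (c i) (c j)) * hε
  let φ : ((Fin k → K) × (Fin k → K)) →ₗ[K] V :=
    (Fintype.linearCombination K (fun i => (b i : V))).coprod (Fintype.linearCombination K c')
  have hφ : ∀ a, φ a = ∑ i, a.1 i • (b i : V) + ∑ i, a.2 i • c' i := by
    intro a
    simp [φ, Fintype.linearCombination_apply]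
  have form : ∀ a a', B (φ a) (φ a') = ∑ i, (a.1 i * a'.2 i + ε * (a.2 i * a'.1 i)) := by
    intro a a'
    simp only [hφ, map_add, map_sum, map_smul, LinearMap.add_apply, LinearMap.sum_apply, LinearMap.smul_apply,
      hbb, hcc, hbc, hs (b _ : V) (c' _)]
    simp [Finset.sum_add_distrib]
    rw [add_comm]
    congr 1
    · exact Finset.sum_congr rfl fun i _ => mul_comm _ _
    · refine Finset.sum_congr rfl fun i _ => ?_; ring
  have hε0 : ε ≠ 0 := by rintro rfl; simp at hε
  have inj : Function.Injective φ := by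
    rw [← LinearMap.ker_eq_bot, LinearMap.ker_eq_bot']
    intro a ha
    have := fun a' => form a a'
    simp only [ha, map_zero, LinearMap.zero_apply] at this
    ext i
    · have := this (0, Pi.single i 1)
      simpa [Pi.single_apply] using this.symm
    · have := this (Pi.single i 1, 0)
      simpa [Pi.single_apply, hε0] using this.symm
  have surj : Function.Surjective φ := by
    intro x
    have hy : x - ∑ i, B (b i : V) x • c' i ∈ L := by
      rw [hL]
      intro y hy
      have h1 : ∀ j, B (b j : V) (x - ∑ i, B (b i : V) x • c' i) = 0 := by
        intro j
        simp only [map_sub, map_sum, map_smul, hbc]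
        simp
      have h4 : (⟨y, hy⟩ : L) = ∑ i, b.repr ⟨y, hy⟩ i • b i := (b.sum_repr _).symm
      have h5 : y = ∑ i, b.repr ⟨y, hy⟩ i • (b i : V) := by
        have := congrArg Subtype.val h4
        simpa only [Submodule.coe_sum, Submodule.coe_smul] using this
      rw [h5]
      simp only [map_sum, map_smul, LinearMap.sum_apply, LinearMap.smul_apply, h1, smul_zero, Finset.sum_const_zero]
    refine ⟨(fun i => b.repr ⟨_, hy⟩ i, fun i => B (b i : V) x), ?_⟩
    rw [hφ]
    have := congrArg Subtype.val (b.sum_repr ⟨_, hy⟩)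
    simp only [Submodule.coe_sum, Submodule.coe_smul] at this
    simp only
    rw [this, sub_add_cancel]
  exact ⟨k, LinearEquiv.ofBijective φ ⟨inj, surj⟩, form⟩

theorem hyp_of_lagr (h2 : (2:K) ≠ 0) [FiniteDimensional K V] (Q : QuadraticForm K V)
    (hQ : QNondeg Q) (L : Submodule K V)
    (hL : ∀ x, x ∈ L ↔ ∀ y ∈ L, QuadraticMap.polar Q y x = 0) : ∃ k, QIsom (HypSum K k) Q := by
  obtain ⟨k, φ, h⟩ := lagr_std h2 1 (by ring) (QuadraticMap.polarBilin Q)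
    (fun x y => by simp [QuadraticMap.polar_comm Q x y]) (fun x hx => hQ x (by simpa using hx)) L (by simpa using hL)
  refine ⟨k, LinearEquiv.trans (M₂ := (Fin k → K) × (Fin k → K)) { toFun := fun f => (fun i => (f i).1, fun i => (f i).2), invFun := fun g i => (g.1 i, g.2 i), map_add' := fun _ _ => rfl, map_smul' := fun _ _ => rfl, left_inv := fun _ => rfl, right_inv := fun _ => rfl } φ, fun x => ?_⟩
  have := h (fun i => (x i).1, fun i => (x i).2) (fun i => (x i).1, fun i => (x i).2)
  rw [QuadraticMap.polarBilin_apply_apply, QuadraticMap.polar_self] at this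
  apply mul_left_cancel₀ h2
  simp only [LinearEquiv.trans_apply, LinearEquiv.coe_mk, LinearMap.coe_mk, AddHom.coe_mk]
  simp only [smul_eq_mul, nsmul_eq_mul, Nat.cast_ofNat] at this
  refine this.trans ?_
  simp only [HypSum, HypForm, QuadraticMap.pi_apply, QuadraticMap.linMulLin_apply, LinearMap.fst_apply, LinearMap.snd_apply, Finset.mul_sum]
  refine Finset.sum_congr rfl fun i _ => ?_
  ring

theorem exists_lagr [FiniteDimensional K V]
    (B : V →ₗ[K] V →ₗ[K] K) (hs : ∀ x, B x x = 0) :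
    ∃ L : Submodule K V, ∀ x, x ∈ L ↔ ∀ y ∈ L, B y x = 0 := by
  have hsk : ∀ x y, B y x = - B x y := by
    intro x y
    have := hs (x + y)
    simp [hs] at this
    linear_combination this
  obtain ⟨L, hL, hmax⟩ := WellFounded.has_min (wellFounded_gt (α := Submodule K V))
    {L : Submodule K V | ∀ x ∈ L, ∀ y ∈ L, B y x = 0} ⟨⊥, by simp⟩
  refine ⟨L, fun x => ⟨fun hx => hL x hx, fun hx => ?_⟩⟩
  by_contra hxL
  refine hmax (L ⊔ K ∙ x) ?_ ?_
  · intro u hu v hv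
    rw [Submodule.mem_sup] at hu hv
    obtain ⟨u1, hu1, u2, hu2, rfl⟩ := hu
    obtain ⟨v1, hv1, v2, hv2, rfl⟩ := hv
    rw [Submodule.mem_span_singleton] at hu2 hv2
    obtain ⟨s, rfl⟩ := hu2
    obtain ⟨t, rfl⟩ := hv2
    simp [hL u1 hu1 v1 hv1, hx v1 hv1, hs, hsk u1 x, hx u1 hu1]
  · show L < _
    refine lt_of_le_of_ne le_sup_left ?_
    intro h
    apply hxL
    rw [h]
    exact Submodule.mem_sup_right (Submodule.mem_span_singleton_self x)

theorem symp_std (h2 : (2:K) ≠ 0) [FiniteDimensional K V] (B : V →ₗ[K] V →ₗ[K] K)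
    (hs : ∀ x y, B y x = - B x y) (nd : ∀ x, (∀ y, B x y = 0) → x = 0) :
    ∃ k, ∃ φ : ((Fin k → K) × (Fin k → K)) ≃ₗ[K] V, ∀ a b,
      B (φ a) (φ b) = ∑ i, (a.1 i * b.2 i + (-1) * (a.2 i * b.1 i)) := by
  obtain ⟨L, hL⟩ := exists_lagr B (fun x => by
    have := hs x x
    have h3 : 2 * B x x = 0 := by linear_combination this
    exact (mul_eq_zero.1 h3).resolve_left h2)
  exact lagr_std h2 (-1) (by ring) B (fun x y => by rw [hs]; ring) nd L hL

theorem symp_unique (h2 : (2:K) ≠ 0) [FiniteDimensional K V] (B B' : V →ₗ[K] V →ₗ[K] K)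
    (hs : ∀ x y, B y x = - B x y) (nd : ∀ x, (∀ y, B x y = 0) → x = 0)
    (hs' : ∀ x y, B' y x = - B' x y) (nd' : ∀ x, (∀ y, B' x y = 0) → x = 0) :
    ∃ g : V ≃ₗ[K] V, ∀ v w, B' (g v) (g w) = B v w := by
  obtain ⟨k, φ, h⟩ := symp_std h2 B hs nd
  obtain ⟨k', φ', h'⟩ := symp_std h2 B' hs' nd'
  have h1 := φ.finrank_eq
  have h3 := φ'.finrank_eq
  simp at h1 h3
  have : k = k' := by omega
  subst this
  refine ⟨φ.symm.trans φ', fun v w => ?_⟩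
  rw [LinearEquiv.trans_apply, LinearEquiv.trans_apply, h', ← h, LinearEquiv.apply_symm_apply, LinearEquiv.apply_symm_apply]

theorem symp_exists (m : ℕ) (hm : Even m) : ∃ B : (Fin m → K) →ₗ[K] (Fin m → K) →ₗ[K] K,
    (∀ x y, B y x = - B x y) ∧ (∀ x, (∀ y, B x y = 0) → x = 0) := by
  obtain ⟨k, rfl⟩ := hm
  let e : (Fin (k + k) → K) ≃ₗ[K] ((Fin k → K) × (Fin k → K)) :=
    (LinearEquiv.funCongrLeft K K finSumFinEquiv).trans (LinearEquiv.sumArrowLequivProdArrow _ _ K K)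
  let B0 : ((Fin k → K) × (Fin k → K)) →ₗ[K] ((Fin k → K) × (Fin k → K)) →ₗ[K] K :=
    LinearMap.mk₂ K (fun a b => ∑ i, (a.1 i * b.2 i - a.2 i * b.1 i))
      (by intros; simp only [← Finset.sum_add_distrib]; refine Finset.sum_congr rfl fun i _ => ?_; simp; ring)
      (by intros; simp only [smul_eq_mul, Finset.mul_sum]; refine Finset.sum_congr rfl fun i _ => ?_; simp; ring)
      (by intros; simp only [← Finset.sum_add_distrib]; refine Finset.sum_congr rfl fun i _ => ?_; simp; ring)
      (by intros; simp only [smul_eq_mul, Finset.mul_sum]; refine Finset.sum_congr rfl fun i _ => ?_; simp; ring)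
  refine ⟨B0.compl₁₂ e.toLinearMap e.toLinearMap, ?_, ?_⟩
  · intro x y
    simp only [LinearMap.compl₁₂_apply, B0, LinearMap.mk₂_apply, ← Finset.sum_neg_distrib]
    refine Finset.sum_congr rfl fun i _ => ?_
    ring
  · intro x hx
    rw [← e.map_eq_zero_iff]
    have h : ∀ y, B0 (e x) y = 0 := by
      intro y
      simpa using hx (e.symm y)
    simp only [B0, LinearMap.mk₂_apply] at h
    ext i
    · have := h (0, Pi.single i 1)
      simpa [Pi.single_apply] using this
    · have := h (Pi.single i 1, 0)
      simpa [Pi.single_apply] using this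
end Lagr

section PiClass
variable {K : Type} [Field K] {T : Type} [AddCommGroup T] {dd : T → ℕ} (D : WD K T dd)

theorem hasClass_pi : ∀ (ι : Type) [Fintype ι] (M : ι → Type) [∀ i, AddCommGroup (M i)] [∀ i, Module K (M i)]
    (Q : ∀ i, QuadraticForm K (M i)) (t : ι → T), (∀ i, D.HasClass (Q i) (t i)) →
    D.HasClass (QuadraticMap.pi Q) (∑ i, t i) := by
  intro ι _
  refine Fintype.induction_empty_option (P := fun ι _ => ∀ (M : ι → Type) [∀ i, AddCommGroup (M i)] [∀ i, Module K (M i)]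
    (Q : ∀ i, QuadraticForm K (M i)) (t : ι → T), (∀ i, D.HasClass (Q i) (t i)) →
    D.HasClass (QuadraticMap.pi Q) (∑ i, t i)) ?_ ?_ ?_ ι
  · intro α β _ e ih M _ _ Q t h
    letI := Fintype.ofEquiv β e.symm
    have := ih (fun a => M (e a)) (fun a => Q (e a)) (fun a => t (e a)) (fun a => h _)
    rw [show ∑ a, t (e a) = ∑ b, t b from e.sum_comp t] at this
    refine WD.HasClass.congr D this ⟨LinearEquiv.piCongrLeft K M e, fun x => ?_⟩
    rw [QuadraticMap.pi_apply, QuadraticMap.pi_apply, ← e.sum_comp]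
    refine Finset.sum_congr rfl fun i _ => ?_
    congr 1
    exact Equiv.piCongrLeft_apply_apply M e x i
  · intro M _ _ Q t h
    simp only [Finset.univ_eq_empty, Finset.sum_empty]
    refine WD.HasClass.congr D (D.hasClass_hyp 0) ⟨⟨0, fun _ => 0, fun _ => Subsingleton.elim _ _, fun _ => Subsingleton.elim _ _⟩, fun x => ?_⟩
    simp [QuadraticMap.pi_apply, HypSum]
  · intro α _ ih M _ _ Q t h
    rw [Fintype.sum_option]
    refine WD.HasClass.congr D (WD.HasClass.prod D (h none) (ih (fun a => M (some a)) (fun a => Q (some a)) (fun a => t (some a)) (fun a => h _)))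
      (QIsom.symm ⟨LinearEquiv.piOptionEquivProd K, fun x => ?_⟩)
    rw [QuadraticMap.prod_apply, QuadraticMap.pi_apply, QuadraticMap.pi_apply, Fintype.sum_option]
    rfl
end PiClass

section HQ
variable {K : Type} [Field K] {V : Type} [AddCommGroup V] [Module K V]
/-- the quadratic form of a bilinear form -/
noncomputable def hq (B : V →ₗ[K] V →ₗ[K] K) : QuadraticForm K V := (2⁻¹ : K) • LinearMap.BilinMap.toQuadraticMap B
theorem hq_apply (B : V →ₗ[K] V →ₗ[K] K) (x : V) : hq B x = 2⁻¹ * B x x := rfl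
theorem hq_polar (h2 : (2:K) ≠ 0) (B : V →ₗ[K] V →ₗ[K] K) (hs : ∀ x y, B x y = B y x) (x y : V) :
    QuadraticMap.polar (hq B) x y = B x y := by
  simp only [QuadraticMap.polar, hq_apply, map_add, LinearMap.add_apply]
  rw [hs y x]
  field_simp
  ring
theorem hq_nondeg (h2 : (2:K) ≠ 0) (B : V →ₗ[K] V →ₗ[K] K) (hs : ∀ x y, B x y = B y x)
    (nd : ∀ x, (∀ y, B x y = 0) → x = 0) : QNondeg (hq B) := by
  intro v hv
  exact nd v (fun y => by rw [← hq_polar h2 B hs, hv])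
end HQ

theorem sum_dite_sub {K ι : Type} [AddCommMonoid K] [Fintype ι] (p : ι → Prop) [DecidablePred p] (F : {j // p j} → K) :
    ∑ j, (if h : p j then F ⟨j, h⟩ else 0) = ∑ j : {j // p j}, F j := by
  have h1 : ∑ j : {j // p j}, F j = ∑ j : {j // p j}, (fun j : ι => if h : p j then F ⟨j, h⟩ else 0) j.1 := by
    refine Finset.sum_congr rfl fun j _ => ?_
    simp [j.2]
  rw [h1, ← Finset.sum_subtype (Finset.univ.filter p) (by simp) (fun j : ι => if h : p j then F ⟨j, h⟩ else 0), Finset.sum_filter]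
  refine Finset.sum_congr rfl fun j _ => ?_
  split_ifs <;> rfl

section Form
variable {K : Type} [Field K] {n : ℕ} {m : Fin n → ℕ}

/-- the model form -/
def BB (β : ∀ j : Fin n, (Fin (m j) → K) →ₗ[K] (Fin (m j) → K) →ₗ[K] K) : MM K n m →ₗ[K] MM K n m →ₗ[K] K :=
  ∑ j : Fin n, ∑ i : Fin ((j:ℕ)+1), ((-1)^(i:ℕ) : K) • (β j).compl₁₂
    ((LinearMap.proj i).comp (LinearMap.proj (R := K) (φ := fun j : Fin n => Fin ((j:ℕ)+1) → Fin (m j) → K) j))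
    ((LinearMap.proj i.rev).comp (LinearMap.proj (R := K) (φ := fun j : Fin n => Fin ((j:ℕ)+1) → Fin (m j) → K) j))

variable (β : ∀ j : Fin n, (Fin (m j) → K) →ₗ[K] (Fin (m j) → K) →ₗ[K] K)

theorem BB_apply (f g : MM K n m) :
    BB β f g = ∑ j : Fin n, ∑ i : Fin ((j:ℕ)+1), (-1)^(i:ℕ) * β j (f j i) (g j i.rev) := by
  simp [BB]

theorem BB_ee (j : Fin n) (i : Fin ((j:ℕ)+1)) (v : Fin (m j) → K) (g : MM K n m) :
    BB β (ee j i v) g = (-1)^(i:ℕ) * β j v (g j i.rev) := by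
  rw [BB_apply, Finset.sum_eq_single j, Finset.sum_eq_single i]
  · rw [ee_apply_same, if_pos rfl]
  · intro i' _ h
    rw [ee_apply_same, if_neg h]; simp
  · simp
  · intro l _ h
    rw [ee_apply_ne _ _ h]; simp
  · simp


theorem neg_one_rev {k : ℕ} (i : Fin (k+1)) : ((-1:K))^(k - (i:ℕ)) * (-1)^k = (-1)^(i:ℕ) := by
  have hi : (i:ℕ) ≤ k := by omega
  obtain ⟨l, hl⟩ := Nat.exists_eq_add_of_le hi
  have : k - (i:ℕ) = l := by omega
  rw [this, show ((-1:K))^k = (-1)^((i:ℕ)+l) from congrArg _ hl, pow_add, mul_left_comm, ← mul_pow]; simp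

theorem BB_SK (hs : ∀ j v w, β j v w = (-1)^(j:ℕ) * β j w v) (nd : ∀ j v, (∀ w, β j v w = 0) → v = 0) : SK (XX K n m) (BB β) := by
  have nd' : ∀ j w, (∀ v, β j v w = 0) → w = 0 := by
    intro j w h
    apply nd j w
    intro v
    rw [hs, h, mul_zero]
  have symm : ∀ f g, BB β f g = BB β g f := by
    intro f g
    rw [BB_apply, BB_apply]
    refine Finset.sum_congr rfl fun j _ => ?_
    rw [← Equiv.sum_comp Fin.revPerm]
    refine Finset.sum_congr rfl fun i _ => ?_
    simp only [Fin.revPerm_apply, Fin.rev_rev]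
    rw [hs, ← mul_assoc]
    congr 1
    rw [← neg_one_rev i, Fin.val_rev]
    congr 2
    omega
  refine ⟨symm, ?_, ?_⟩
  · intro f hf
    ext1 j; ext1 i
    apply nd' j
    intro v
    have := hf (ee j i.rev v)
    rw [symm, BB_ee, Fin.rev_rev] at this
    simpa using this
  · intro f g
    rw [BB_apply, BB_apply, ← Finset.sum_neg_distrib]
    refine Finset.sum_congr rfl fun j _ => ?_
    rw [Fin.sum_univ_succ, Fin.sum_univ_castSucc]
    have h0 : XX K n m f j 0 = 0 := by simp [XX]
    have h1 : XX K n m g j (Fin.last _).rev = 0 := by simp [XX]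
    rw [h0, h1]
    simp only [map_zero, LinearMap.zero_apply, mul_zero, zero_add, add_zero, ← Finset.sum_neg_distrib]
    refine Finset.sum_congr rfl fun i _ => ?_
    have h3 : XX K n m f j i.succ = f j i.castSucc := by simp [XX]; rfl
    have h4 : XX K n m g j i.castSucc.rev = g j i.succ.rev := by
      simp only [XX, LinearMap.coe_mk, AddHom.coe_mk]
      rw [dif_pos]
      · congr 1
      · rw [Fin.val_rev]; simp; try omega
    rw [h3, h4]
    simp [pow_succ]

theorem BB_bet (j : Fin n) (v w : Fin (m j) → K) : bet (BB β) j v w = β j v w := by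
  unfold bet
  rw [XX_top, BB_ee, ee_apply_same]
  simp

/-- sign -/
def eps (K : Type) [Field K] {n : ℕ} (j : Fin n) : K := (-1)^((j:ℕ)/2)

theorem BB_class (hs : ∀ j v w, β j v w = (-1)^(j:ℕ) * β j w v) (nd : ∀ j v, (∀ w, β j v w = 0) → v = 0) (h2 : (2:K) ≠ 0) {T : Type} [AddCommGroup T] {dd : T → ℕ} (D : WD K T dd)
    (t : {j : Fin n // Even (j:ℕ)} → T) (ht : ∀ j, D.HasClass (eps K j.1 • hq (β j.1)) (t j)) :
    D.HasClass (hq (BB β)) (∑ j, t j) := by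
  have hSK := BB_SK β hs nd
  have nd' : ∀ j w, (∀ v, β j v w = 0) → w = 0 := by
    intro j w h
    apply nd j w
    intro v
    rw [hs, h, mul_zero]
  have hsym : ∀ j : {j : Fin n // Even (j:ℕ)}, ∀ x y, β j.1 x y = β j.1 y x := by
    intro j x y
    rw [hs, Even.neg_one_pow j.2, one_mul]
  have heps : ∀ j : Fin n, eps K j ≠ 0 := fun j => by simp [eps]
  obtain ⟨t0, ht0⟩ := D.hasClass_exists (hq (BB β)) (hq_nondeg h2 _ hSK.symm hSK.nd)
  let P2 : QuadraticForm K (∀ j : {j : Fin n // Even (j:ℕ)}, Fin (m j.1) → K) :=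
    QuadraticMap.pi (fun j => -(eps K j.1 • hq (β j.1)))
  have hP2 : D.HasClass P2 (∑ j, -t j) := hasClass_pi D _ _ _ _ (fun j => WD.HasClass.neg D (ht j))
  let P := (hq (BB β)).prod P2
  have hP : D.HasClass P (t0 + ∑ j, -t j) := WD.HasClass.prod D ht0 hP2
  have polP : ∀ x y, QuadraticMap.polar P x y = BB β x.1 y.1 - ∑ j : {j : Fin n // Even (j:ℕ)}, eps K j.1 * β j.1 (x.2 j) (y.2 j) := by
    intro x y
    have e1 : QuadraticMap.polar P x y = QuadraticMap.polar (hq (BB β)) x.1 y.1 +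
      ∑ j : {j : Fin n // Even (j:ℕ)}, -(eps K j.1 * QuadraticMap.polar (hq (β j.1)) (x.2 j) (y.2 j)) := by
      have : ∀ u : ∀ j : {j : Fin n // Even (j:ℕ)}, Fin (m j.1) → K, P2 u = ∑ j : {j : Fin n // Even (j:ℕ)}, -(eps K j.1 * hq (β j.1) (u j)) := by
        intro u; simp [P2, QuadraticMap.pi_apply]
      have h3 : ∀ j : {j : Fin n // Even (j:ℕ)}, -(eps K j.1 * QuadraticMap.polar (hq (β j.1)) (x.2 j) (y.2 j)) =
          -(eps K j.1 * hq (β j.1) (x.2 j + y.2 j)) - (-(eps K j.1 * hq (β j.1) (x.2 j))) - (-(eps K j.1 * hq (β j.1) (y.2 j))) := by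
        intro j; unfold QuadraticMap.polar; ring
      simp only [h3, Finset.sum_sub_distrib]
      unfold QuadraticMap.polar
      simp only [P, QuadraticMap.prod_apply, Prod.fst_add, Prod.snd_add, this, Pi.add_apply]
      ring
    rw [e1, hq_polar h2 _ hSK.symm, Finset.sum_neg_distrib, ← sub_eq_add_neg]
    congr 1
    refine Finset.sum_congr rfl fun j _ => ?_
    rw [hq_polar h2 _ (hsym j)]
  let L : Submodule K (MM K n m × ∀ j : {j : Fin n // Even (j:ℕ)}, Fin (m j.1) → K) :=
    { carrier := {x | ∀ (j : Fin n) (i : Fin ((j:ℕ)+1)), (2 * (i:ℕ) < j → x.1 j i = 0) ∧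
          ∀ h : 2 * (i:ℕ) = j, x.1 j i = x.2 ⟨j, ⟨i, by omega⟩⟩}
      add_mem' := by
        intro x y hx hy j i
        refine ⟨fun h => ?_, fun h => ?_⟩
        · simp [(hx j i).1 h, (hy j i).1 h]
        · simp [(hx j i).2 h, (hy j i).2 h]
      zero_mem' := by intro j i; simp
      smul_mem' := by
        intro c x hx j i
        refine ⟨fun h => ?_, fun h => ?_⟩
        · simp [(hx j i).1 h]
        · simp [(hx j i).2 h] }
  have hLmem : ∀ x, x ∈ L ↔ ∀ (j : Fin n) (i : Fin ((j:ℕ)+1)), (2 * (i:ℕ) < j → x.1 j i = 0) ∧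
          ∀ h : 2 * (i:ℕ) = j, x.1 j i = x.2 ⟨j, ⟨i, by omega⟩⟩ := fun x => Iff.rfl
  have hPnd : QNondeg P := by
    intro x hx
    refine Prod.ext ?_ ?_
    · apply hSK.nd
      intro y
      have := hx (y, 0)
      rw [polP] at this
      simpa using this
    · ext1 j
      apply nd
      intro w
      have := hx (0, Pi.single j w)
      rw [polP, Finset.sum_eq_single j] at this
      · simpa [heps] using this
      · intro l _ h; simp [h]
      · simp
  obtain ⟨k, hk⟩ := hyp_of_lagr h2 P hPnd L (by
    intro x
    constructor
    · intro hx y hy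
      rw [hLmem] at hx hy
      rw [polP, sub_eq_zero, BB_apply]
      have key : ∀ j : Fin n, ∑ i : Fin ((j:ℕ)+1), (-1)^(i:ℕ) * β j (y.1 j i) (x.1 j i.rev) =
          if h : Even (j:ℕ) then eps K j * β j (y.2 ⟨j, h⟩) (x.2 ⟨j, h⟩) else 0 := by
        intro j
        split_ifs with h
        · obtain ⟨l, hl⟩ := h
          have hl1 : l < (j:ℕ) + 1 := by omega
          rw [Finset.sum_eq_single (⟨l, hl1⟩ : Fin ((j:ℕ)+1))]
          · have hrev : (⟨l, hl1⟩ : Fin ((j:ℕ)+1)).rev = ⟨l, hl1⟩ := by ext; simp [Fin.val_rev]; omega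
            rw [hrev, (hx j ⟨l, hl1⟩).2 (by simp; omega), (hy j ⟨l, hl1⟩).2 (by simp; omega)]
            congr 2
            simp; omega
          · intro i _ hi
            have hi' : (i:ℕ) ≠ l := fun h => hi (Fin.ext h)
            by_cases h5 : 2 * (i:ℕ) < j
            · rw [(hy j i).1 h5]; simp
            · rw [(hx j i.rev).1 (by rw [Fin.val_rev]; omega)]; simp
          · simp
        · apply Finset.sum_eq_zero
          intro i _
          have hi' : 2 * (i:ℕ) ≠ j := fun h' => h ⟨i, by omega⟩
          by_cases h5 : 2 * (i:ℕ) < j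
          · rw [(hy j i).1 h5]; simp
          · rw [(hx j i.rev).1 (by rw [Fin.val_rev]; omega)]; simp
      rw [Finset.sum_congr rfl (fun j _ => key j)]
      exact sum_dite_sub (fun j : Fin n => Even (j:ℕ)) (fun j => eps K j.1 * β j.1 (y.2 j) (x.2 j))
    · intro hx
      rw [hLmem]
      have key : ∀ (j : Fin n) (i : Fin ((j:ℕ)+1)) , 2 * (i:ℕ) < j → x.1 j i = 0 := by
        intro j i h
        apply nd'
        intro v
        have := hx (ee j i.rev v, 0) (by
          rw [hLmem]
          intro l i'
          by_cases hl : l = j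
          · subst hl
            simp only
            have hr := Fin.val_rev i
            refine ⟨fun h' => ?_, fun h' => ?_⟩ <;>
            · rw [ee_apply_same, if_neg (by rintro rfl; omega)]; try rfl
          · simp only
            rw [ee_apply_ne _ _ hl]; simp)
        rw [polP, BB_ee, Fin.rev_rev] at this
        simpa using this
      intro j i
      refine ⟨key j i, fun h => ?_⟩
      rw [← sub_eq_zero]
      apply nd'
      intro v
      have hrev : i.rev = i := by ext; rw [Fin.val_rev]; omega
      have := hx (ee j i v, Pi.single ⟨j, ⟨i, by omega⟩⟩ v) (by
        rw [hLmem]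
        intro l i'
        by_cases hl : l = j
        · subst hl
          simp only [Pi.single_eq_same]
          rw [ee_apply_same]
          refine ⟨fun h' => if_neg (by rintro rfl; omega), fun h' => if_pos (by ext; omega)⟩
        · simp only
          rw [ee_apply_ne _ _ hl]
          refine ⟨fun _ => rfl, fun h' => ?_⟩
          refine Eq.symm (Pi.single_eq_of_ne ?_ _)
          intro h'; exact hl (congrArg Subtype.val h'))
      rw [polP, BB_ee, hrev, Finset.sum_eq_single (⟨j, ⟨i, by omega⟩⟩ : {j : Fin n // Even (j:ℕ)})] at this
      · simp only [Pi.single_eq_same] at this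
        have h6 : eps K j = (-1)^(i:ℕ) := by simp only [eps]; congr 1; omega
        rw [h6, ← mul_sub, ← map_sub] at this
        simpa using this
      · intro l _ hl; simp [hl]
      · simp)
  have h0 := D.hasClass_unique hP (WD.HasClass.congr D (D.hasClass_hyp k) hk)
  rw [Finset.sum_neg_distrib, add_neg_eq_zero] at h0
  rw [← h0]
  exact ht0
end Form

section Jordan
variable {K : Type} [Field K] {n : ℕ}

/-- multiplicities -/
def mu (lam : Nat.Partition n) (j : Fin n) : ℕ := lam.parts.count ((j:ℕ)+1)

theorem parts_sum_count (lam : Nat.Partition n) (f : ℕ → ℕ) :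
    (lam.parts.map f).sum = ∑ j : Fin n, mu lam j * f ((j:ℕ)+1) := by
  rw [Finset.sum_multiset_map_count]
  unfold mu
  rw [Fin.sum_univ_eq_sum_range (fun j => lam.parts.count (j+1) * f (j+1)) n]
  rw [Finset.sum_subset (s₂ := (Finset.range n).map ⟨Nat.succ, Nat.succ_injective⟩), Finset.sum_map]
  · simp
  · intro k hk
    rw [Multiset.mem_toFinset] at hk
    have h1 := lam.parts_pos hk
    have h2 : k ≤ n := by
      have := Multiset.single_le_sum (fun x _ => Nat.zero_le x) k hk
      rwa [lam.parts_sum] at this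
    simp only [Finset.mem_map, Finset.mem_range, Function.Embedding.coeFn_mk]
    exact ⟨k - 1, by omega, by omega⟩
  · intro k _ hk
    rw [Multiset.mem_toFinset] at hk
    simp [Multiset.count_eq_zero_of_notMem hk]

theorem finrank_MM (m : Fin n → ℕ) : Module.finrank K (MM K n m) = ∑ j : Fin n, m j * ((j:ℕ)+1) := by
  simp only [MM, Module.finrank_pi_fintype, Module.finrank_self]
  simp [mul_comm]

theorem finrank_MM_mu (lam : Nat.Partition n) : Module.finrank K (MM K n (mu lam)) = n := by
  rw [finrank_MM, ← parts_sum_count lam (fun k => k)]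
  simp [lam.parts_sum]

/-- kernel description -/
def kerE (m : Fin n → ℕ) (k : ℕ) : LinearMap.ker ((XX K n m)^k) ≃ₗ[K] (∀ j : Fin n, Fin (min k ((j:ℕ)+1)) → Fin (m j) → K) where
  toFun f j l := f.1 j ⟨(j:ℕ) + 1 - min k ((j:ℕ)+1) + l, by omega⟩
  map_add' f g := rfl
  map_smul' c f := rfl
  invFun g := ⟨fun j t => if h : (j:ℕ) + 1 - min k ((j:ℕ)+1) ≤ t then g j ⟨t - ((j:ℕ) + 1 - min k ((j:ℕ)+1)), by omega⟩ else 0, by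
    rw [LinearMap.mem_ker, XX_ker]
    intro j i hi
    rw [dif_neg (by omega)]⟩
  left_inv f := by
    apply Subtype.ext
    ext1 j; ext1 t
    simp only
    split_ifs with h
    · apply congrArg (f.1 j); apply Fin.ext; show (j:ℕ) + 1 - min k ((j:ℕ)+1) + ((t:ℕ) - ((j:ℕ) + 1 - min k ((j:ℕ)+1))) = t; omega
    · symm
      exact (XX_ker k f.1).1 f.2 j t (by omega)
  right_inv g := by
    ext1 j; ext1 l
    simp

theorem XX_jordan (lam : Nat.Partition n) : HasJordanType (XX K n (mu lam)) lam := by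
  intro i
  rw [(kerE (mu lam) i).finrank_eq, parts_sum_count lam (fun k => min i k)]
  simp only [Module.finrank_pi_fintype, Module.finrank_self]
  simp [mul_comm]

variable {V : Type} [AddCommGroup V] [Module K V] [FiniteDimensional K V]

theorem finrank_map_ker (X : Module.End K V) (i : ℕ) :
    Module.finrank K ((LinearMap.ker (X^(i+1))).map X) + Module.finrank K (LinearMap.ker X) =
      Module.finrank K (LinearMap.ker (X^(i+1))) := by
  have h := LinearMap.finrank_range_add_finrank_ker (X.domRestrict (LinearMap.ker (X^(i+1))))
  rw [LinearMap.range_domRestrict] at h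
  rw [← h]
  congr 1
  have : LinearMap.ker (X.domRestrict (LinearMap.ker (X^(i+1)))) = (LinearMap.ker X).comap (LinearMap.ker (X^(i+1))).subtype := by
    ext x; simp
  rw [this]
  refine (LinearEquiv.finrank_eq (Submodule.comapSubtypeEquivOfLe ?_)).symm
  intro x hx
  rw [LinearMap.mem_ker] at hx ⊢
  rw [pow_succ, Module.End.mul_apply, hx, map_zero]

theorem exists_W (X : Module.End K V) (i c : ℕ)
    (hc : 2 * Module.finrank K (LinearMap.ker (X^(i+1))) = Module.finrank K (LinearMap.ker (X^i)) +
      Module.finrank K (LinearMap.ker (X^(i+2))) + c) :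
    ∃ σ : (Fin c → K) →ₗ[K] V, LinearMap.ker (X^(i+1)) =
      (LinearMap.ker (X^i) ⊔ (LinearMap.ker (X^(i+2))).map X) ⊔ LinearMap.range σ := by
  set A := LinearMap.ker (X^(i+1))
  set S := LinearMap.ker (X^i) ⊔ (LinearMap.ker (X^(i+2))).map X with hS
  have hSA : S ≤ A := by
    rw [hS, sup_le_iff]
    constructor
    · intro x hx
      rw [LinearMap.mem_ker] at hx ⊢
      rw [pow_succ', Module.End.mul_apply, hx, map_zero]
    · rintro _ ⟨y, hy, rfl⟩
      have hy' : (X^(i+2)) y = 0 := hy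
      rw [LinearMap.mem_ker, ← Module.End.mul_apply, ← pow_succ]
      exact hy'
  obtain ⟨C, hC⟩ := Submodule.exists_isCompl S
  have h1 : S ⊔ (C ⊓ A) = A := by
    rw [← sup_inf_assoc_of_le C hSA, hC.sup_eq_top, top_inf_eq]
  have h2 : S ⊓ (C ⊓ A) = ⊥ := by
    rw [← inf_assoc, hC.inf_eq_bot, bot_inf_eq]
  have d1 := Submodule.finrank_sup_add_finrank_inf_eq S (C ⊓ A)
  rw [h1, h2, finrank_bot] at d1
  have d2 := Submodule.finrank_sup_add_finrank_inf_eq (LinearMap.ker (X^i)) ((LinearMap.ker (X^(i+2))).map X)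
  have h3 : LinearMap.ker (X^i) ⊓ (LinearMap.ker (X^(i+2))).map X = A.map X := by
    ext x
    constructor
    · rintro ⟨hx, y, hy, rfl⟩
      refine ⟨y, ?_, rfl⟩
      have : (X^i) (X y) = 0 := hx
      show (X^(i+1)) y = 0
      rw [pow_succ, Module.End.mul_apply, this]
    · rintro ⟨y, hy, rfl⟩
      have hy' : (X^(i+1)) y = 0 := hy
      refine ⟨?_, y, ?_, rfl⟩
      · show (X^i) (X y) = 0
        rw [← Module.End.mul_apply, ← pow_succ, hy']
      · show (X^(i+2)) y = 0
        rw [pow_succ', Module.End.mul_apply, hy', map_zero]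
  rw [h3, ← hS] at d2
  have d3 := finrank_map_ker X i
  have d4 := finrank_map_ker X (i+1)
  have d5 : Module.finrank K (C ⊓ A : Submodule K V) = c := by
    change Module.finrank K (A.map X) + _ = Module.finrank K A at d3
    rw [show i + 1 + 1 = i + 2 from rfl] at d4
    omega
  let e : (Fin c → K) ≃ₗ[K] (C ⊓ A : Submodule K V) := LinearEquiv.ofFinrankEq _ _ (by simp [d5])
  refine ⟨(C ⊓ A).subtype.comp e.toLinearMap, ?_⟩
  rw [LinearMap.range_comp, LinearEquiv.range, Submodule.map_top, Submodule.range_subtype, h1]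

theorem jordan_conj (lam : Nat.Partition n) (hV : Module.finrank K V = n) (X : Module.End K V)
    (hX : HasJordanType X lam) :
    ∃ θ : MM K n (mu lam) ≃ₗ[K] V, ∀ f, θ (XX K n (mu lam) f) = X (θ f) := by
  have hk : ∀ i, Module.finrank K (LinearMap.ker (X^i)) = ∑ j : Fin n, mu lam j * min i ((j:ℕ)+1) := by
    intro i; rw [hX i, parts_sum_count lam (fun k => min i k)]
  have hσ : ∀ j : Fin n, ∃ σ : (Fin (mu lam j) → K) →ₗ[K] V, LinearMap.ker (X^((j:ℕ)+1)) =
      (LinearMap.ker (X^(j:ℕ)) ⊔ (LinearMap.ker (X^((j:ℕ)+2))).map X) ⊔ LinearMap.range σ := by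
    intro j
    apply exists_W
    rw [hk, hk, hk]
    have : mu lam j = ∑ l : Fin n, if l = j then mu lam l else 0 := by simp
    conv_rhs => rw [this]
    rw [Finset.mul_sum, ← Finset.sum_add_distrib, ← Finset.sum_add_distrib]
    refine Finset.sum_congr rfl fun l _ => ?_
    split_ifs with h
    · subst h
      rw [min_eq_left (by omega), min_eq_left (by omega), min_eq_right (by omega)]
      ring
    · have h' : (l:ℕ) ≠ j := fun h' => h (Fin.ext h')
      rcases lt_or_gt_of_ne h' with h1 | h1
      · rw [min_eq_right (by omega), min_eq_right (by omega), min_eq_right (by omega)]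
        ring
      · rw [min_eq_left (by omega), min_eq_left (by omega), min_eq_left (by omega)]
        ring
  choose σ hσ using hσ
  have hσ0 : ∀ (j : Fin n) w, (X^((j:ℕ)+1)) (σ j w) = 0 := by
    intro j w
    have : σ j w ∈ LinearMap.ker (X^((j:ℕ)+1)) := by
      rw [hσ]; exact Submodule.mem_sup_right ⟨w, rfl⟩
    exact this
  let θ0 : MM K n (mu lam) →ₗ[K] V := ∑ j : Fin n, ∑ i : Fin ((j:ℕ)+1), (X^(i:ℕ)).comp ((σ j).comp
    ((LinearMap.proj i).comp (LinearMap.proj (R := K) (φ := fun j : Fin n => Fin ((j:ℕ)+1) → Fin (mu lam j) → K) j)))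
  have hθ : ∀ f, θ0 f = ∑ j : Fin n, ∑ i : Fin ((j:ℕ)+1), (X^(i:ℕ)) (σ j (f j i)) := by
    intro f; simp [θ0]
  have hcomm : ∀ f, θ0 (XX K n (mu lam) f) = X (θ0 f) := by
    intro f
    rw [hθ, hθ, map_sum]
    refine Finset.sum_congr rfl fun j _ => ?_
    rw [map_sum, Fin.sum_univ_succ, Fin.sum_univ_castSucc]
    have h0 : XX K n (mu lam) f j 0 = 0 := by simp [XX]
    have h1 : X ((X^((Fin.last (j:ℕ) : Fin ((j:ℕ)+1)):ℕ)) (σ j (f j (Fin.last _)))) = 0 := by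
      rw [← Module.End.mul_apply, ← pow_succ']
      exact hσ0 _ _
    rw [h0, h1]
    simp only [map_zero, zero_add, add_zero]
    refine Finset.sum_congr rfl fun i _ => ?_
    have h3 : XX K n (mu lam) f j i.succ = f j i.castSucc := by simp [XX]; rfl
    rw [h3, ← Module.End.mul_apply, ← pow_succ']
    rfl
  have hr1 : ∀ x ∈ LinearMap.range θ0, X x ∈ LinearMap.range θ0 := by
    rintro _ ⟨f, rfl⟩
    exact ⟨_, hcomm f⟩
  have hr2 : ∀ j, LinearMap.range (σ j) ≤ LinearMap.range θ0 := by
    rintro j _ ⟨w, rfl⟩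
    refine ⟨sg j w, ?_⟩
    rw [hθ, Finset.sum_eq_single j, Finset.sum_eq_single 0]
    · rw [ee_apply_same]; simp
    · intro i _ h; rw [ee_apply_same, if_neg h]; simp
    · simp
    · intro l _ h; rw [ee_apply_ne _ _ h]; simp
    · simp
  have hXn : LinearMap.ker (X^n) = ⊤ := by
    apply Submodule.eq_top_of_finrank_eq
    rw [hV, hk]
    have h5 := parts_sum_count lam (fun k => k)
    rw [Multiset.map_id', lam.parts_sum] at h5
    refine Eq.trans ?_ h5.symm
    refine Finset.sum_congr rfl fun j _ => ?_
    rw [min_eq_right (by omega)]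
  have down : ∀ k i, i + k = n → LinearMap.ker (X^(i+1)) ≤ LinearMap.range θ0 ⊔ LinearMap.ker (X^i) := by
    intro k
    induction k with
    | zero =>
      intro i hi
      have : i = n := by omega
      subst this
      rw [hXn]; simp
    | succ k ih =>
      intro i hi
      have h6 := hσ ⟨i, by omega⟩
      simp only at h6
      rw [h6, sup_le_iff, sup_le_iff]
      refine ⟨⟨le_sup_right, ?_⟩, (hr2 _).trans le_sup_left⟩
      rintro _ ⟨y, hy, rfl⟩
      have hy' := ih (i+1) (by omega) hy
      rw [Submodule.mem_sup] at hy'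
      obtain ⟨r, hr, z, hz, rfl⟩ := hy'
      rw [map_add]
      refine Submodule.add_mem_sup (hr1 r hr) ?_
      have hz' : (X^(i+1)) z = 0 := hz
      rw [LinearMap.mem_ker, ← Module.End.mul_apply, ← pow_succ, hz']
  have up : ∀ i, i ≤ n → LinearMap.ker (X^i) ≤ LinearMap.range θ0 := by
    intro i
    induction i with
    | zero => intro _ x hx; simp at hx; rw [hx]; exact zero_mem _
    | succ i ih =>
      intro hi
      exact (down (n - i) i (by omega)).trans (sup_le le_rfl (ih (by omega)))
  have hsurj : Function.Surjective θ0 := by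
    rw [← LinearMap.range_eq_top, eq_top_iff, ← hXn]
    exact up n le_rfl
  have hinj : Function.Injective θ0 :=
    (LinearMap.injective_iff_surjective_of_finrank_eq_finrank (by rw [finrank_MM_mu, hV])).2 hsurj
  exact ⟨LinearEquiv.ofBijective θ0 ⟨hinj, hsurj⟩, hcomm⟩

theorem jordan_of_conj (lam : Nat.Partition n) (X : Module.End K V)
    (θ : MM K n (mu lam) ≃ₗ[K] V) (h : ∀ f, θ (XX K n (mu lam) f) = X (θ f)) :
    HasJordanType X lam ∧ IsNilpotent X := by
  have hp : ∀ k f, θ (((XX K n (mu lam))^k) f) = (X^k) (θ f) := by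
    intro k
    induction k with
    | zero => simp
    | succ k ih => intro f; rw [pow_succ, pow_succ, Module.End.mul_apply, Module.End.mul_apply, ih, h]
  constructor
  · intro i
    rw [← XX_jordan (K := K) lam i]
    have : LinearMap.ker (X^i) = (LinearMap.ker ((XX K n (mu lam))^i)).map θ.toLinearMap := by
      ext x
      constructor
      · intro hx
        refine ⟨θ.symm x, ?_, by simp⟩
        have hx' : (X^i) x = 0 := hx
        show ((XX K n (mu lam))^i) (θ.symm x) = 0
        rw [← θ.map_eq_zero_iff, hp]
        simpa using hx'
      · rintro ⟨f, hf, rfl⟩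
        have hf' : ((XX K n (mu lam))^i) f = 0 := hf
        show (X^i) (θ f) = 0
        rw [← hp, hf', map_zero]
    rw [this]
    exact LinearEquiv.finrank_map_eq θ _
  · refine ⟨n+1, LinearMap.ext fun x => ?_⟩
    obtain ⟨f, rfl⟩ := θ.surjective x
    rw [← hp, XX_nilp]; simp
end Jordan

section Assembly
variable {K : Type} [Field K] {n : ℕ} {m : Fin n → ℕ}

/-- bilinear version of `bet` -/
def betL (B : MM K n m →ₗ[K] MM K n m →ₗ[K] K) (j : Fin n) : (Fin (m j) → K) →ₗ[K] (Fin (m j) → K) →ₗ[K] K :=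
  B.compl₁₂ (sg j) (((XX K n m)^(j:ℕ)).comp (sg j))

theorem betL_apply (B : MM K n m →ₗ[K] MM K n m →ₗ[K] K) (j : Fin n) (v w : Fin (m j) → K) :
    betL B j v w = bet B j v w := rfl

theorem eps_sq (j : Fin n) : eps K j * eps K j = 1 := by
  unfold eps; rw [← mul_pow]; simp

variable {T : Type} [AddCommGroup T] {dd : T → ℕ} (D : WD K T dd)

/-- the invariants -/
def CLS (B : MM K n m →ₗ[K] MM K n m →ₗ[K] K) (t : {j : Fin n // Even (j:ℕ)} → T) : Prop :=
  ∀ j, D.HasClass (eps K j.1 • hq (betL B j.1)) (t j)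

variable {B B' : MM K n m →ₗ[K] MM K n m →ₗ[K] K}

theorem betL_sym (h : SK (XX K n m) B) (j : {j : Fin n // Even (j:ℕ)}) (v w) : betL B j.1 v w = betL B j.1 w v := by
  rw [betL_apply, bet_symm h, Even.neg_one_pow j.2, one_mul]; rfl

theorem eps_polar (h2 : (2:K) ≠ 0) (h : SK (XX K n m) B) (j : {j : Fin n // Even (j:ℕ)}) (v w) :
    QuadraticMap.polar (eps K j.1 • hq (betL B j.1)) v w = eps K j.1 * bet B j.1 v w := by
  rw [← betL_apply, ← hq_polar h2 _ (betL_sym h j)]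
  simp only [QuadraticMap.polar, QuadraticMap.smul_apply, smul_eq_mul]
  ring

theorem eps_ne (j : Fin n) : eps K j ≠ 0 := by simp [eps]

theorem eps_nondeg (h2 : (2:K) ≠ 0) (h : SK (XX K n m) B) (j : {j : Fin n // Even (j:ℕ)}) :
    QNondeg (eps K j.1 • hq (betL B j.1)) := by
  intro v hv
  apply bet_nd h j.1 v
  intro w
  have := hv w
  have h3 := eps_polar h2 h j v w
  have h4 : eps K j.1 * bet B j.1 v w = 0 := h3.symm.trans this
  exact (mul_eq_zero.1 h4).resolve_left (eps_ne _)

theorem CLS_exists (h : SK (XX K n m) B) : ∃ t, CLS D B t := by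
  have : ∀ j : {j : Fin n // Even (j:ℕ)}, ∃ t, D.HasClass (eps K j.1 • hq (betL B j.1)) t :=
    fun j => D.hasClass_exists _ (eps_nondeg D.two h j)
  choose t ht using this
  exact ⟨t, ht⟩

theorem CLS_range (h : SK (XX K n m) B) {t} (ht : CLS D B t) (j) : dd (t j) ≤ m j.1 ∧ dd (t j) % 2 = m j.1 % 2 :=
  (D.hasClass_range (m j.1) (Fin (m j.1) → K) (by simp) (t j)).1 ⟨_, eps_nondeg D.two h j, ht j⟩

theorem CLS_C (h : SK (XX K n m) B) (h' : SK (XX K n m) B') {t} (ht : CLS D B t) (ht' : CLS D B' t) :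
    ∃ C : MM K n m ≃ₗ[K] MM K n m, (∀ f, C (XX K n m f) = XX K n m (C f)) ∧ ∀ x y, B' (C x) (C y) = B x y := by
  apply core_bwd D.two h h'
  intro j
  by_cases hj : Even (j:ℕ)
  · obtain ⟨φ, hφ⟩ := WD.HasClass.isom D (ht ⟨j, hj⟩) (ht' ⟨j, hj⟩) rfl
    refine ⟨φ, fun v w => ?_⟩
    have h1 := QIsom.polar hφ v w
    have h3 := eps_polar D.two h ⟨j, hj⟩ v w
    have h4 := eps_polar D.two h' ⟨j, hj⟩ (φ v) (φ w)
    have h5 : eps K j * bet B' j (φ v) (φ w) = eps K j * bet B j v w := h4.symm.trans (h1.trans h3)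
    exact mul_left_cancel₀ (eps_ne j) h5
  · rw [Nat.not_even_iff_odd] at hj
    have hsym : ∀ {B : MM K n m →ₗ[K] MM K n m →ₗ[K] K}, SK (XX K n m) B → ∀ v w, betL B j w v = - betL B j v w := by
      intro B h v w
      rw [betL_apply, bet_symm h, hj.neg_one_pow, neg_one_mul]; rfl
    exact symp_unique D.two (betL B j) (betL B' j) (hsym h) (bet_nd h j) (hsym h') (bet_nd h' j)

theorem C_CLS (h : SK (XX K n m) B) (h' : SK (XX K n m) B') (C : MM K n m ≃ₗ[K] MM K n m) (hC : ∀ f, C (XX K n m f) = XX K n m (C f))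
    (hCB : ∀ x y, B' (C x) (C y) = B x y) {t} (ht : CLS D B t) : CLS D B' t := by
  intro j
  obtain ⟨g, hg⟩ := core_fwd h h' C hC hCB j.1
  refine WD.HasClass.congr D (ht j) ⟨g, fun x => ?_⟩
  simp only [QuadraticMap.smul_apply, hq_apply, betL_apply, hg]

theorem CLS_sum (h : SK (XX K n m) B) {t} (ht : CLS D B t) : D.HasClass (hq B) (∑ j, t j) := by
  have hs := fun j v w => bet_symm h j v w
  have nd := fun j v => bet_nd h j v
  have h0 := BB_class (betL B) hs nd D.two D t ht
  have hSK := BB_SK (betL B) hs nd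
  obtain ⟨C, hC, hCB⟩ := core_bwd D.two hSK h (fun j => ⟨LinearEquiv.refl K _, fun v w => by
    rw [BB_bet]; rfl⟩)
  refine WD.HasClass.congr D h0 ⟨C, fun x => ?_⟩
  rw [hq_apply, hq_apply, hCB]

variable {V : Type} [AddCommGroup V] [Module K V]

/-- transported polar form -/
noncomputable def BT (Q : QuadraticForm K V) (θ : MM K n m ≃ₗ[K] V) : MM K n m →ₗ[K] MM K n m →ₗ[K] K :=
  (QuadraticMap.polarBilin Q).compl₁₂ θ.toLinearMap θ.toLinearMap

theorem BT_apply (Q : QuadraticForm K V) (θ : MM K n m ≃ₗ[K] V) (x y) : BT Q θ x y = QuadraticMap.polar Q (θ x) (θ y) := rfl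

theorem BT_SK (Q : QuadraticForm K V) (hQ : QNondeg Q) (θ : MM K n m ≃ₗ[K] V) (X : Module.End K V) (hX : X ∈ soSet Q)
    (hθ : ∀ f, θ (XX K n m f) = X (θ f)) : SK (XX K n m) (BT Q θ) := by
  refine ⟨fun x y => ?_, fun x hx => ?_, fun x y => ?_⟩
  · rw [BT_apply, BT_apply, QuadraticMap.polar_comm]
  · rw [← θ.map_eq_zero_iff]
    apply hQ
    intro w
    have := hx (θ.symm w)
    rw [BT_apply] at this
    simpa using this
  · rw [BT_apply, BT_apply, hθ, hθ]
    exact eq_neg_of_add_eq_zero_left (hX _ _)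

theorem BT_isom (h2 : (2:K) ≠ 0) (Q : QuadraticForm K V) (θ : MM K n m ≃ₗ[K] V) : QIsom (hq (BT Q θ)) Q := by
  refine ⟨θ, fun x => ?_⟩
  rw [hq_apply, BT_apply, QuadraticMap.polar_self]
  simp only [nsmul_eq_mul, Nat.cast_ofNat, smul_eq_mul]
  field_simp

theorem orbit_card (Q : QF K n) (hQ : QNondeg Q) (lam : Nat.Partition n) (hlam : lam ∈ LambdaSet n)
    (w : T) (hw : D.HasClass Q w) :
    Nat.card (Quot (fun
      (X Y : {X : Module.End K (Fin n → K) //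
        X ∈ soSet Q ∧ IsNilpotent X ∧ HasJordanType X lam}) =>
      ∃ g : (Fin n → K) ≃ₗ[K] (Fin n → K), InO Q g ∧ Y.1 = (LinearEquiv.conj g) X.1)) =
    Nat.card {x : {j : Fin n // Even (j:ℕ)} → T // (∀ j, dd (x j) ≤ mu lam j.1 ∧ dd (x j) % 2 = mu lam j.1 % 2) ∧ ∑ j, x j = w} := by
  have h2 := D.two
  have hθ : ∀ X : {X : Module.End K (Fin n → K) // X ∈ soSet Q ∧ IsNilpotent X ∧ HasJordanType X lam},
      ∃ θ : MM K n (mu lam) ≃ₗ[K] (Fin n → K), ∀ f, θ (XX K n (mu lam) f) = X.1 (θ f) :=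
    fun X => jordan_conj lam (by simp) X.1 X.2.2.2
  choose θ hθ using hθ
  have hSK := fun X => BT_SK Q hQ (θ X) X.1 X.2.1 (hθ X)
  have ht := fun X => CLS_exists D (hSK X)
  choose t ht using ht
  let F : {X : Module.End K (Fin n → K) // X ∈ soSet Q ∧ IsNilpotent X ∧ HasJordanType X lam} →
      {x : {j : Fin n // Even (j:ℕ)} → T // (∀ j, dd (x j) ≤ mu lam j.1 ∧ dd (x j) % 2 = mu lam j.1 % 2) ∧ ∑ j, x j = w} :=
    fun X => ⟨t X, fun j => CLS_range D (hSK X) (ht X) j,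
      D.hasClass_unique (WD.HasClass.congr D (CLS_sum D (hSK X) (ht X)) (BT_isom h2 Q (θ X))) hw⟩
  have uniq : ∀ X t', CLS D (BT Q (θ X)) t' → t X = t' := by
    intro X t' h'
    funext j
    exact D.hasClass_unique (ht X j) (h' j)
  have hF1 : ∀ X Y, (∃ g : (Fin n → K) ≃ₗ[K] (Fin n → K), InO Q g ∧ Y.1 = (LinearEquiv.conj g) X.1) → F X = F Y := by
    rintro X Y ⟨g, hg, hY⟩
    apply Subtype.ext
    symm
    apply uniq Y
    refine C_CLS D (hSK X) (hSK Y) ((θ X).trans (g.trans (θ Y).symm)) (fun f => ?_) (fun x y => ?_) (ht X)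
    · apply (θ Y).injective
      rw [hθ Y, hY]
      simp [LinearEquiv.conj_apply, hθ X]
    · rw [BT_apply, BT_apply, ← QIsom.polar hg (θ X x) (θ X y)]
      simp
  have hF2 : ∀ X Y, F X = F Y → (∃ g : (Fin n → K) ≃ₗ[K] (Fin n → K), InO Q g ∧ Y.1 = (LinearEquiv.conj g) X.1) := by
    intro X Y h
    have h' : t X = t Y := congrArg Subtype.val h
    obtain ⟨C, hC, hCB⟩ := CLS_C D (hSK X) (hSK Y) (ht X) (h' ▸ ht Y)
    refine ⟨(θ X).symm.trans (C.trans (θ Y)), fun v => ?_, ?_⟩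
    · obtain ⟨x, rfl⟩ := (θ X).surjective v
      have := hCB x x
      rw [BT_apply, BT_apply, QuadraticMap.polar_self, QuadraticMap.polar_self] at this
      simp only [nsmul_eq_mul, Nat.cast_ofNat, smul_eq_mul] at this
      simpa using mul_left_cancel₀ h2 this
    · refine LinearMap.ext fun v => ?_
      obtain ⟨y, rfl⟩ := (θ Y).surjective v
      obtain ⟨x, rfl⟩ := C.surjective y
      rw [LinearEquiv.conj_apply]
      simp [← hθ, hC]
  have hF3 : Function.Surjective F := by
    rintro ⟨x, hx1, hx2⟩
    have hex : ∀ j : Fin n, ∃ β : (Fin (mu lam j) → K) →ₗ[K] (Fin (mu lam j) → K) →ₗ[K] K,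
        (∀ v w, β v w = (-1)^(j:ℕ) * β w v) ∧ (∀ v, (∀ w, β v w = 0) → v = 0) ∧
        ∀ h : Even (j:ℕ), D.HasClass (eps K j • hq β) (x ⟨j, h⟩) := by
      intro j
      by_cases hj : Even (j:ℕ)
      · obtain ⟨q, hq1, hq2⟩ := (D.hasClass_range (mu lam j) (Fin (mu lam j) → K) (by simp) (x ⟨j, hj⟩)).2 (hx1 ⟨j, hj⟩)
        refine ⟨eps K j • QuadraticMap.polarBilin q, fun v w => ?_, fun v hv => ?_, fun _ => ?_⟩
        · rw [hj.neg_one_pow, one_mul]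
          simp [QuadraticMap.polar_comm q v w]
        · apply hq1
          intro w
          have := hv w
          simpa [eps_ne] using this
        · have : eps K j • hq (eps K j • QuadraticMap.polarBilin q) = q := by
            ext v
            simp only [QuadraticMap.smul_apply, hq_apply, LinearMap.smul_apply, QuadraticMap.polarBilin_apply_apply, QuadraticMap.polar_self,
              smul_eq_mul, nsmul_eq_mul, Nat.cast_ofNat]
            field_simp
            linear_combination (q v) * eps_sq (K := K) j
          rw [this]
          exact hq2
      · have hj' := hj
        rw [Nat.not_even_iff_odd] at hj
        obtain ⟨β, h1, h3⟩ := symp_exists (K := K) (mu lam j) (hlam _ (by simpa using hj.add_one))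
        refine ⟨β, fun v w => ?_, h3, fun h => absurd h hj'⟩
        rw [hj.neg_one_pow, h1]; ring
    choose β hs nd hcl using hex
    have hBSK := BB_SK β hs nd
    have hc : CLS D (BB β) x := by
      intro j
      have : betL (BB β) j.1 = β j.1 := by
        refine LinearMap.ext₂ fun v w => ?_
        rw [betL_apply, BB_bet]
      rw [this]
      exact hcl j.1 j.2
    have hsum := CLS_sum D hBSK hc
    rw [hx2] at hsum
    obtain ⟨φ, hφ⟩ := WD.HasClass.isom D hsum hw (by rw [finrank_MM_mu]; simp)
    have hXX : ∀ f, φ (XX K n (mu lam) f) = (φ.conj (XX K n (mu lam))) (φ f) := by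
      intro f; simp [LinearEquiv.conj_apply]
    obtain ⟨hJ, hN⟩ := jordan_of_conj lam _ φ hXX
    have hpol : ∀ x y, QuadraticMap.polar Q (φ x) (φ y) = BB β x y := by
      intro x y
      rw [QIsom.polar hφ, hq_polar h2 _ hBSK.symm]
    let X : {X : Module.End K (Fin n → K) // X ∈ soSet Q ∧ IsNilpotent X ∧ HasJordanType X lam} :=
      ⟨φ.conj (XX K n (mu lam)), by
        intro v w
        obtain ⟨f, rfl⟩ := φ.surjective v
        obtain ⟨g, rfl⟩ := φ.surjective w
        rw [← hXX, ← hXX, hpol, hpol, hBSK.skew]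
        ring, hN, hJ⟩
    refine ⟨X, Subtype.ext ?_⟩
    apply uniq X
    refine C_CLS D hBSK (hSK X) (φ.trans (θ X).symm) (fun f => ?_) (fun f g => ?_) hc
    · apply (θ X).injective
      rw [hθ X]
      simp only [LinearEquiv.trans_apply, LinearEquiv.apply_symm_apply]
      exact hXX f
    · rw [BT_apply, ← hpol]
      simp
  refine Nat.card_congr (Equiv.ofBijective (Quot.lift F hF1) ⟨?_, ?_⟩)
  · intro a b
    induction a using Quot.ind
    induction b using Quot.ind
    intro h
    exact Quot.sound (hF2 _ _ h)
  · intro x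
    obtain ⟨X, hX⟩ := hF3 x
    exact ⟨Quot.mk _ X, hX⟩

theorem filter_card (lam : Nat.Partition n) (P : ℕ → Prop) [DecidablePred P] (hP : ¬ P 0) :
    (lam.parts.toFinset.filter (fun j => Odd j ∧ P (lam.parts.count j))).card =
    (Finset.univ.filter (fun j : {j : Fin n // Even (j:ℕ)} => P (mu lam j.1))).card := by
  symm
  refine Finset.card_bij (fun j _ => (j.1:ℕ)+1) ?_ ?_ ?_
  · intro j hj
    simp only [Finset.mem_filter, Finset.mem_univ, true_and, Multiset.mem_toFinset] at hj ⊢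
    refine ⟨?_, j.2.add_one, hj⟩
    by_contra h
    apply hP
    have : mu lam j.1 = 0 := Multiset.count_eq_zero_of_notMem h
    rwa [this] at hj
  · intro a _ b _ h
    apply Subtype.ext
    apply Fin.ext
    omega
  · intro k hk
    simp only [Finset.mem_filter, Multiset.mem_toFinset] at hk
    obtain ⟨hk, ho, hp⟩ := hk
    have h2 : k ≤ n := by
      have := Multiset.single_le_sum (fun x _ => Nat.zero_le x) k hk
      rwa [lam.parts_sum] at this
    obtain ⟨l, hl⟩ := ho
    refine ⟨⟨⟨k - 1, by omega⟩, ⟨l, by simp only; omega⟩⟩, ?_, by simp only; omega⟩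
    rw [Finset.mem_filter]
    refine ⟨Finset.mem_univ _, ?_⟩
    have h7 : mu lam ⟨k - 1, by omega⟩ = lam.parts.count k := by
      show lam.parts.count (k - 1 + 1) = _
      rw [show k - 1 + 1 = k by omega]
    simp only [h7]
    exact hp

theorem parity_mu (lam : Nat.Partition n) (hlam : lam ∈ LambdaSet n) :
    n % 2 = (∑ j : {j : Fin n // Even (j:ℕ)}, mu lam j.1) % 2 := by
  have h5 := parts_sum_count lam (fun k => k)
  rw [Multiset.map_id', lam.parts_sum] at h5
  rw [← sum_dite_sub (fun j : Fin n => Even (j:ℕ)) (fun j => mu lam j.1)]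
  have h6 : n % 2 = (∑ j : Fin n, mu lam j * ((j:ℕ)+1)) % 2 := congrArg (· % 2) h5
  rw [h6, Finset.sum_nat_mod, Finset.sum_nat_mod (f := fun j : Fin n => if h : Even (j:ℕ) then mu lam j else 0)]
  congr 1
  refine Finset.sum_congr rfl fun j _ => ?_
  split_ifs with h
  · obtain ⟨l, hl⟩ := h
    rw [hl, show mu lam j * (l + l + 1) = mu lam j + 2 * (mu lam j * l) by ring]
    omega
  · rw [Nat.not_even_iff_odd] at h
    obtain ⟨l, hl⟩ := hlam _ (by simpa using h.add_one)
    have : mu lam j = l + l := hl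
    rw [this, ← two_mul, mul_assoc]
    omega

theorem final_of (D : WD K T dd) (η : T) [Fintype T] [DecidableEq T] (hCD : CD T dd η) (Q : QF K n) (hQ : QNondeg Q)
    (d : ℕ) (Q₀ : QF K d) (hQ₀ : QuadraticMap.Anisotropic Q₀) (hW : WittEquiv Q₀ Q)
    (lam : Nat.Partition n) (hlam : lam ∈ LambdaSet n)
    (a b c : ℕ)
    (ha : a = (lam.parts.toFinset.filter (fun j => Odd j ∧ lam.parts.count j = 1)).card)
    (hb : b = (lam.parts.toFinset.filter (fun j => Odd j ∧ lam.parts.count j = 2)).card)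
    (hc : c = (lam.parts.toFinset.filter (fun j => Odd j ∧ 3 ≤ lam.parts.count j)).card)
    (N : ℕ)
    (hN : N = Nat.card (Quot (fun
      (X Y : {X : Module.End K (Fin n → K) //
        X ∈ soSet Q ∧ IsNilpotent X ∧ HasJordanType X lam}) =>
      ∃ g : (Fin n → K) ≃ₗ[K] (Fin n → K), InO Q g ∧ Y.1 = (LinearEquiv.conj g) X.1))) :
    (1 ≤ c → (8 : ℤ) * N = 4 ^ a * 7 ^ b * 8 ^ c) ∧
    (c = 0 → 0 < a → (8 : ℤ) * N = 4 ^ a * 7 ^ b + (2 - (d : ℤ)) * 2 ^ (a + 1)) ∧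
    (a = 0 → c = 0 → (N : ℤ) = (7 ^ b - (-1 : ℤ) ^ b) / 8 +
      (if d = 0 ∧ Even b then (1 : ℤ) else if d = 4 ∧ Odd b then -1 else 0)) := by
  have h2 := D.two
  obtain ⟨w, hw⟩ := D.hasClass_exists Q hQ
  have hQ₀n : QNondeg Q₀ := by
    intro v hv
    have := hv v
    rw [QuadraticMap.polar_self] at this
    simp only [nsmul_eq_mul, Nat.cast_ofNat, smul_eq_mul] at this
    exact hQ₀ v ((mul_eq_zero.1 this).resolve_left h2)
  obtain ⟨w', hw'⟩ := D.hasClass_exists Q₀ hQ₀n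
  have hww : w' = w := by
    obtain ⟨k, l, hkl⟩ := hW
    have := D.hasClass_unique (WD.HasClass.congr D (WD.HasClass.prod D hw' (D.hasClass_hyp k)) hkl) (WD.HasClass.prod D hw (D.hasClass_hyp l))
    simpa using this
  subst hww
  have hd : d = dd w' := by
    have := D.aniso_hasClass hw' hQ₀
    simpa using this
  have hpar : dd w' % 2 = n % 2 :=
    ((D.hasClass_range n (Fin n → K) (by simp) w').1 ⟨Q, hQ, hw⟩).2
  rw [orbit_card D Q hQ lam hlam w' hw] at hN
  rw [hd]
  exact count_main hCD (fun j : {j : Fin n // Even (j:ℕ)} => mu lam j.1) w' N hN (by rw [hpar, parity_mu lam hlam]) a b c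
    (by rw [ha]; exact filter_card lam (fun k => k = 1) (by simp))
    (by rw [hb]; exact filter_card lam (fun k => k = 2) (by simp))
    (by rw [hc]; exact filter_card lam (fun k => 3 ≤ k) (by simp))
end Assembly

theorem statement_1 (p : ℕ) [Fact p.Prime] (hp : p ≠ 2) (K : Type) [Field K]
    [Algebra ℚ_[p] K] [FiniteDimensional ℚ_[p] K]
    (n : ℕ) (Q : QF K n) (hQ : QNondeg Q)
    (d : ℕ) (Q₀ : QF K d) (hQ₀ : QuadraticMap.Anisotropic Q₀) (hW : WittEquiv Q₀ Q)
    (lam : Nat.Partition n) (hlam : lam ∈ LambdaSet n)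
    (a b c : ℕ)
    (ha : a = (lam.parts.toFinset.filter (fun j => Odd j ∧ lam.parts.count j = 1)).card)
    (hb : b = (lam.parts.toFinset.filter (fun j => Odd j ∧ lam.parts.count j = 2)).card)
    (hc : c = (lam.parts.toFinset.filter (fun j => Odd j ∧ 3 ≤ lam.parts.count j)).card)
    (N : ℕ)
    (hN : N = Nat.card (Quot (fun
      (X Y : {X : Module.End K (Fin n → K) //
        X ∈ soSet Q ∧ IsNilpotent X ∧ HasJordanType X lam}) =>
      ∃ g : (Fin n → K) ≃ₗ[K] (Fin n → K), InO Q g ∧ Y.1 = (LinearEquiv.conj g) X.1))) :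
    (1 ≤ c → (8 : ℤ) * N = 4 ^ a * 7 ^ b * 8 ^ c) ∧
    (c = 0 → 0 < a → (8 : ℤ) * N = 4 ^ a * 7 ^ b + (2 - (d : ℤ)) * 2 ^ (a + 1)) ∧
    (a = 0 → c = 0 → (N : ℤ) = (7 ^ b - (-1 : ℤ) ^ b) / 8 +
      (if d = 0 ∧ Even b then (1 : ℤ) else if d = 4 ∧ Odd b then -1 else 0)) := by
  rcases exists_wd p hp K with ⟨⟨D⟩⟩ | ⟨⟨D⟩⟩
  · exact final_of D _ cd1 Q hQ d Q₀ hQ₀ hW lam hlam a b c ha hb hc N hN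
  · exact final_of D _ cd2 Q hQ d Q₀ hQ₀ hW lam hlam a b c ha hb hc N hN
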